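/- arXiv:1602.02146 — 5 statements merged into one kernel-verified Lean document; each statement's English description precedes it below -/
import Mathlib

section
/- Let M be a topological manifold and let G be a subgroup of the group Homeo(M) of homeomorphisms of M satisfying property (*). Then for every Hausdorff group topology τ on G and all open sets U, V ⊆ M, the set C(U,V) = {f ∈ G : f(cl(U)) ⊆ cl(V)} is closed in (G, τ). -/
/-- The group of self-homeomorphisms of a space, with `(f * g) x = f (g x)`. -/
instance Homeomorph.instGroupSelf {M : Type*} [TopologicalSpace M] : Group (Homeomorph M M) where
  mul f g := g.trans f
  one := Homeomorph.refl M
  inv := Homeomorph.symm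
  mul_assoc f g h := Homeomorph.ext fun _ => rfl
  one_mul f := Homeomorph.ext fun _ => rfl
  mul_one f := Homeomorph.ext fun _ => rfl
  inv_mul_cancel f := Homeomorph.ext fun x => f.symm_apply_apply x

/-- Homeomorphisms supported in disjoint sets commute. -/
theorem Homeomorph.commute_of_forall_notMem_eq {M : Type*} [TopologicalSpace M]
    {k h : Homeomorph M M} {A B : Set M} (hAB : Disjoint A B)
    (hk : ∀ x ∉ A, k x = x) (hh : ∀ x ∉ B, h x = x) : Commute k h := by
  have mem : ∀ {e : Homeomorph M M} {S : Set M}, (∀ x ∉ S, e x = x) → ∀ x ∈ S, e x ∈ S := by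
    intro e S he x hx
    by_contra hc
    exact hc ((e.injective (he _ hc)).symm ▸ hx)
  refine Homeomorph.ext fun x => ?_
  change k (h x) = h (k x)
  by_cases hx : x ∈ A
  · rw [hh x (hAB.notMem_of_mem_left hx), hh _ (hAB.notMem_of_mem_left (mem hk x hx))]
  · rw [hk x hx]
    by_cases hxB : x ∈ B
    · exact hk _ (hAB.notMem_of_mem_right (mem hh x hxB))
    · rw [hh x hxB, hk x hx]

/-- A non-identity homeomorphism of a Hausdorff space displaces some nonempty open set inside any
given open set that supports it. -/
theorem Homeomorph.exists_isOpen_forall_notMem {M : Type*} [TopologicalSpace M] [T2Space M]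
    {h : Homeomorph M M} (h1 : h ≠ 1) {O : Set M} (hO : IsOpen O) (hh : ∀ x ∉ O, h x = x) :
    ∃ A ⊆ O, IsOpen A ∧ A.Nonempty ∧ ∀ x ∈ A, h x ∉ A := by
  obtain ⟨y, hy⟩ : ∃ y, h y ≠ y := by
    by_contra! hc
    exact h1 (Homeomorph.ext hc)
  obtain ⟨P, Q, hP, hQ, hyP, hyQ, hPQ⟩ := t2_separation hy.symm
  refine ⟨O ∩ (P ∩ h ⁻¹' Q), Set.inter_subset_left, hO.inter (hP.inter (hQ.preimage h.continuous)),
    ⟨y, ?_, hyP, hyQ⟩, fun x hx hc => hPQ.notMem_of_mem_left hc.2.1 hx.2.2⟩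
  by_contra hyO
  exact hy (hh y hyO)

/-- If `G` has non-identity elements supported in every nonempty open set, then `f ∈ G` maps
`closure U` into `closure V` iff conjugating by `f` the elements of `G` supported in `U` gives
elements commuting with all elements of `G` supported off `closure V`. -/
theorem Homeomorph.image_closure_subset_closure_iff_commute {M : Type*} [TopologicalSpace M]
    [T2Space M] (G : Subgroup (Homeomorph M M))
    (hstar : ∀ U : Set M, IsOpen U → U.Nonempty → ∃ g ∈ G, g ≠ 1 ∧ ∀ x ∉ U, g x = x)
    {U : Set M} (hU : IsOpen U) (V : Set M) (f : G) :
    ⇑(f : Homeomorph M M) '' closure U ⊆ closure V ↔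
      ∀ g h : G, (∀ x ∉ U, (g : Homeomorph M M) x = x) →
        (∀ x ∉ (closure V)ᶜ, (h : Homeomorph M M) x = x) → f * g * f⁻¹ * h = h * (f * g * f⁻¹) := by
  obtain ⟨f, hf⟩ := f
  have apply_symm : ∀ x, f (f⁻¹ x) = x := f.apply_symm_apply
  constructor
  · rintro hUV ⟨g, hg⟩ ⟨h, hh⟩ hgU hhV
    refine Subtype.ext (Homeomorph.commute_of_forall_notMem_eq (k := f * g * f⁻¹) (A := f '' U)
      (B := (closure V)ᶜ) ?_ (fun x hx => ?_) hhV)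
    · exact Set.disjoint_compl_right_iff_subset.2 ((Set.image_mono subset_closure).trans hUV)
    · change f (g (f⁻¹ x)) = x
      rw [hgU _ fun hc => hx ⟨_, hc, apply_symm x⟩, apply_symm]
  · intro H
    refine (image_closure_subset_closure_image f.continuous).trans
      (closure_minimal ?_ isClosed_closure)
    by_contra hne
    obtain ⟨y, hyU, hyV⟩ := Set.not_subset.1 hne
    have hO : IsOpen (f '' U ∩ (closure V)ᶜ) :=
      (f.isOpenMap U hU).inter isClosed_closure.isOpen_compl
    obtain ⟨h, hhG, h1, hh⟩ := hstar _ hO ⟨y, hyU, hyV⟩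
    obtain ⟨A, hAO, hA, ⟨a, ha⟩, hAh⟩ := Homeomorph.exists_isOpen_forall_notMem h1 hO hh
    obtain ⟨g, hgG, g1, hg⟩ := hstar (f ⁻¹' A) (hA.preimage f.continuous)
      ⟨f⁻¹ a, by rwa [Set.mem_preimage, apply_symm]⟩
    refine g1 (Homeomorph.ext fun x => ?_)
    by_cases hx : x ∈ f ⁻¹' A
    · have hcomm := H ⟨g, hgG⟩ ⟨h, hhG⟩
        (fun z hz => hg z fun hc => hz (f.injective.mem_set_image.1 (hAO hc).1))
        (fun z hz => hh z fun hc => hz hc.2)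
      have key : f (g (f⁻¹ (h (f x)))) = h (f (g (f⁻¹ (f x)))) :=
        DFunLike.congr_fun (congrArg Subtype.val hcomm) (f x)
      have symm_apply : f⁻¹ (f x) = x := f.symm_apply_apply x
      rw [hg (f⁻¹ (h (f x))) (by rw [Set.mem_preimage, apply_symm]; exact hAh _ hx), apply_symm,
        symm_apply] at key
      exact (f.injective (h.injective key)).symm
    · exact hg x hx

/-- **Kallman's lemma.** Let `M` be a topological manifold and `G ⊆ Homeo(M)` a subgroup
satisfying property (*): for each nonempty open `U ⊆ M` there is a non-identity `g ∈ G`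
fixing `M \ U` pointwise.  Then for any Hausdorff group topology on `G` and any open sets
`U, V ⊆ M`, the set `C(U,V) = {f ∈ G : f(cl U) ⊆ cl V}` is closed in `G`. -/
theorem closed_CUV_of_hausdorff_group_topology
    {n : ℕ} {M : Type*} [TopologicalSpace M] [T2Space M]
    [ChartedSpace (EuclideanSpace ℝ (Fin n)) M]
    (G : Subgroup (Homeomorph M M))
    (hstar : ∀ U : Set M, IsOpen U → U.Nonempty →
      ∃ g ∈ G, g ≠ 1 ∧ ∀ x ∉ U, g x = x)
    [τ : TopologicalSpace G] [IsTopologicalGroup G] [T2Space G]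
    (U V : Set M) (hU : IsOpen U) (hV : IsOpen V) :
    IsClosed {f : G | ⇑(f : Homeomorph M M) '' closure U ⊆ closure V} := by
  simp only [Homeomorph.image_closure_subset_closure_iff_commute G hstar hU V, Set.ofPred_forall]
  exact isClosed_iInter fun g => isClosed_iInter fun h => isClosed_iInter fun _ =>
    isClosed_iInter fun _ => isClosed_eq (by fun_prop) (by fun_prop)
end

section
/- Let M be a topological manifold and let G be a subgroup of Homeo(M) satisfying property (*). Then for all open sets U, V ⊆ M and every f ∈ G, the following are equivalent: (i) f(cl(U)) ⊆ cl(V); (ii) for every nonempty open U' ⊆ U, every nonempty open W' ⊆ M ∖ cl(V), and all g, h ∈ G such that g(x) = x for all x ∉ U' and h(x) = x for all x ∉ W', the elements f g f⁻¹ and h commute. -/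
/-- Homeomorphisms with disjoint supports commute. -/
theorem Homeomorph.commute_of_disjoint_support {X : Type*} [TopologicalSpace X]
    {g h : Homeomorph X X} {A B : Set X} (hAB : Disjoint A B)
    (hg : ∀ x ∉ A, g x = x) (hh : ∀ x ∉ B, h x = x) : Commute g h := by
  have mem_of_mem : ∀ (k : Homeomorph X X) (C : Set X), (∀ x ∉ C, k x = x) →
      ∀ x ∈ C, k x ∈ C := by
    intro k C hk x hx
    by_contra hkx
    exact hkx ((k.injective (hk _ hkx)).symm ▸ hx)
  refine Homeomorph.ext fun x => ?_
  change g (h x) = h (g x)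
  by_cases hxA : x ∈ A
  · rw [hh x (hAB.notMem_of_mem_left hxA),
      hh _ (hAB.notMem_of_mem_left (mem_of_mem g A hg x hxA))]
  · rw [hg x hxA]
    by_cases hxB : x ∈ B
    · exact hg _ (hAB.notMem_of_mem_right (mem_of_mem h B hh x hxB))
    · rw [hh x hxB, hg x hxA]

/-- If every nonempty open set supports a nontrivial element of `G`, then every nonempty open set
supports two elements of `G` that do not commute. -/
theorem Homeomorph.exists_not_commute_of_supported {X : Type*} [TopologicalSpace X] [T2Space X]
    {G : Subgroup (Homeomorph X X)}
    (hG : ∀ U : Set X, IsOpen U → U.Nonempty → ∃ g ∈ G, g ≠ 1 ∧ ∀ x ∉ U, g x = x)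
    {O : Set X} (hO : IsOpen O) (hne : O.Nonempty) :
    ∃ g ∈ G, ∃ k ∈ G, (∀ x ∉ O, g x = x) ∧ (∀ x ∉ O, k x = x) ∧ ¬ Commute g k := by
  have exists_moved : ∀ k : Homeomorph X X, k ≠ 1 → ∃ x, k x ≠ x := by
    intro k hk
    by_contra! hfix
    exact hk (Homeomorph.ext hfix)
  obtain ⟨g, hgG, hg1, hg⟩ := hG O hO hne
  obtain ⟨x, hx⟩ := exists_moved g hg1
  have hxO : x ∈ O := by
    by_contra hxO
    exact hx (hg x hxO)
  obtain ⟨P, Q, hP, hQ, hgxP, hxQ, hPQ⟩ := t2_separation hx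
  obtain ⟨k, hkG, hk1, hk⟩ := hG (O ∩ Q ∩ g ⁻¹' P)
    ((hO.inter hQ).inter (hP.preimage g.continuous)) ⟨x, ⟨hxO, hxQ⟩, hgxP⟩
  obtain ⟨y, hy⟩ := exists_moved k hk1
  have hyA : y ∈ O ∩ Q ∩ g ⁻¹' P := by
    by_contra hyA
    exact hy (hk y hyA)
  refine ⟨g, hgG, k, hkG, hg, fun z hz => hk z fun hzA => hz hzA.1.1, fun hcomm => hy ?_⟩
  have hgy : g (k y) = k (g y) := DFunLike.congr_fun hcomm y
  rw [hk (g y) fun h => hPQ.notMem_of_mem_left hyA.2 h.1.2] at hgy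
  exact g.injective hgy

/-- For a subgroup `G ⊆ Homeo(M)` of a topological manifold `M` satisfying property (*),
open sets `U, V ⊆ M`, and `f ∈ G`: `f(cl U) ⊆ cl V` if and only if for every nonempty open
`U' ⊆ U`, every nonempty open `W' ⊆ M \ cl V`, and all `g, h ∈ G` supported in `U'` and `W'`
respectively, the elements `f g f⁻¹` and `h` commute. -/
theorem image_closure_subset_iff_commute
    {n : ℕ} {M : Type*} [TopologicalSpace M] [T2Space M]
    [ChartedSpace (EuclideanSpace ℝ (Fin n)) M]
    (G : Subgroup (Homeomorph M M))
    (hstar : ∀ U : Set M, IsOpen U → U.Nonempty →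
      ∃ g ∈ G, g ≠ 1 ∧ ∀ x ∉ U, g x = x)
    (U V : Set M) (hU : IsOpen U) (hV : IsOpen V)
    (f : Homeomorph M M) (hf : f ∈ G) :
    ⇑f '' closure U ⊆ closure V ↔
      ∀ U' : Set M, IsOpen U' → U'.Nonempty → U' ⊆ U →
        ∀ W' : Set M, IsOpen W' → W'.Nonempty → W' ⊆ (closure V)ᶜ →
          ∀ g ∈ G, (∀ x ∉ U', g x = x) →
            ∀ h ∈ G, (∀ x ∉ W', h x = x) →
              Commute (f * g * f⁻¹) h := by
  constructor
  · intro hsub U' _ _ hU'U W' _ _ hW'V g _ hg h _ hh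
    refine Homeomorph.commute_of_disjoint_support (A := f '' U') (B := W') ?_ ?_ hh
    · refine Set.disjoint_left.2 fun x hx hxW => hW'V hxW (hsub ?_)
      exact Set.image_mono (hU'U.trans subset_closure) hx
    · intro x hx
      have hfx : f.symm x ∉ U' := fun hmem => hx ⟨f.symm x, hmem, f.apply_symm_apply x⟩
      change f (g (f.symm x)) = x
      rw [hg _ hfx, f.apply_symm_apply]
  · intro hcomm
    suffices hUV : ∀ x ∈ U, f x ∈ closure V by
      rw [Set.image_subset_iff]
      exact closure_minimal hUV (isClosed_closure.preimage f.continuous)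
    intro x hxU
    by_contra hxV
    have hO : IsOpen (U ∩ f ⁻¹' (closure V)ᶜ) :=
      hU.inter (isClosed_closure.isOpen_compl.preimage f.continuous)
    obtain ⟨g, hgG, k, hkG, hg, hk, hgk⟩ :=
      Homeomorph.exists_not_commute_of_supported hstar hO ⟨x, hxU, hxV⟩
    have hconj : Commute (f * g * f⁻¹) (f * k * f⁻¹) := by
      refine hcomm _ hO ⟨x, hxU, hxV⟩ Set.inter_subset_left
        (f.symm ⁻¹' (U ∩ f ⁻¹' (closure V)ᶜ)) (hO.preimage f.symm.continuous)
        ⟨f x, ?_⟩ ?_ g hgG hg (f * k * f⁻¹)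
        (G.mul_mem (G.mul_mem hf hkG) (G.inv_mem hf)) ?_
      · rw [Set.mem_preimage, f.symm_apply_apply]
        exact ⟨hxU, hxV⟩
      · intro z hz
        simpa using hz.2
      · intro z hz
        change f (k (f.symm z)) = z
        rw [hk _ hz, f.apply_symm_apply]
    exact hgk ((Commute.conj_iff f).1 hconj)
end

section
/- For any two elements f, g ∈ PL(I), the subgroup generated by f and g is either abelian or contains a subgroup isomorphic to the free abelian group of countably infinite rank ⨁_{i ∈ ℕ} ℤ. -/
/-- The unit interval `[0,1]`. -/
abbrev UnitInt : Type := Set.Icc (0 : ℝ) 1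

/-- `f` is an orientation-preserving piecewise linear homeomorphism of `[0,1]`:
it is strictly increasing and there is a finite partition `0 = t 0 < t 1 < ⋯ < t k = 1`
such that `f` is affine on each subinterval `[t i, t (i+1)]`. -/
def IsPLHomeo (f : Homeomorph UnitInt UnitInt) : Prop :=
  StrictMono f ∧
    ∃ (k : ℕ) (t : Fin (k + 1) → ℝ), t 0 = 0 ∧ t (Fin.last k) = 1 ∧ StrictMono t ∧
      ∀ i : Fin k, ∃ a b : ℝ, ∀ x : UnitInt,
        (x : ℝ) ∈ Set.Icc (t i.castSucc) (t i.succ) → (f x : ℝ) = a * (x : ℝ) + b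

namespace PLHomeo

open Set Filter Topology
open scoped IsMulCommutative

section Order

variable {X : Type*} [TopologicalSpace X]

theorem mul_apply (a b : Homeomorph X X) (x : X) : (a * b) x = a (b x) := rfl

theorem one_apply (x : X) : (1 : Homeomorph X X) x = x := rfl

theorem inv_apply_self (a : Homeomorph X X) (x : X) : a⁻¹ (a x) = x := a.symm_apply_apply x

theorem apply_inv_self (a : Homeomorph X X) (x : X) : a (a⁻¹ x) = x := a.apply_symm_apply x

theorem inv_apply_eq_self {a : Homeomorph X X} {x : X} (h : a x = x) : a⁻¹ x = x := by
  conv_lhs => rw [← h]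
  exact inv_apply_self a x

theorem zpow_apply_eq_self {a : Homeomorph X X} {x : X} (h : a x = x) (n : ℤ) :
    (a ^ n) x = x := by
  induction n with
  | zero => rfl
  | succ n ih => rw [zpow_add_one, mul_apply, h, ih]
  | pred n ih => rw [zpow_sub_one, mul_apply, inv_apply_eq_self h, ih]

/-- The points fixed by every element of `H`. -/
def fixedSet (H : Subgroup (Homeomorph X X)) : Set X := {x | ∀ m ∈ H, m x = x}

theorem isClosed_fixedSet [T2Space X] (H : Subgroup (Homeomorph X X)) :
    IsClosed (fixedSet H) := by
  have : fixedSet H = ⋂ m ∈ H, {x | m x = x} := by ext; simp [fixedSet]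
  rw [this]
  exact isClosed_biInter fun m _ => isClosed_eq m.continuous continuous_id

/-- Two maps with disjoint supports within an invariant set commute there. -/
theorem commute_on {a b : Homeomorph X X} {D : Set X} (ha : ∀ y ∈ D, a y ∈ D)
    (hb : ∀ y ∈ D, b y ∈ D) (hab : ∀ y ∈ D, a y = y ∨ b y = y) {y : X} (hy : y ∈ D) :
    a (b y) = b (a y) := by
  rcases hab y hy with h | h
  · rcases hab (b y) (hb y hy) with h' | h'
    · rw [h', h]
    · rw [b.injective h', h]
      exact (b.injective h').symm
  · rcases hab (a y) (ha y hy) with h' | h'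
    · rw [h, a.injective h', h]
    · rw [h', h]

variable [LinearOrder X]

theorem inv_strictMono {a : Homeomorph X X} (ha : StrictMono a) : StrictMono ⇑a⁻¹ :=
  fun x y hxy => ha.lt_iff_lt.1 (by rwa [apply_inv_self, apply_inv_self])

theorem pow_succ_apply_ne {a : Homeomorph X X} (ha : StrictMono a) {x : X} (hx : a x ≠ x)
    (n : ℕ) : (a ^ (n + 1)) x ≠ x := by
  rcases hx.lt_or_gt with h | h
  · refine ne_of_lt ?_
    induction n with
    | zero => simpa using h
    | succ n ih => rw [pow_succ', mul_apply]; exact (ha ih).trans h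
  · refine ne_of_gt ?_
    induction n with
    | zero => simpa using h
    | succ n ih => rw [pow_succ', mul_apply]; exact lt_trans h (ha ih)

theorem eq_zero_of_zpow_apply_eq {a : Homeomorph X X} (ha : StrictMono a) {x : X}
    (hx : a x ≠ x) {n : ℤ} (hn : (a ^ n) x = x) : n = 0 := by
  rcases n with (_ | n) | n
  · rfl
  · refine absurd hn ?_
    exact_mod_cast pow_succ_apply_ne ha hx n
  · refine absurd (inv_apply_eq_self hn) ?_
    rw [zpow_negSucc, inv_inv]
    exact pow_succ_apply_ne ha hx n

variable {H : Subgroup (Homeomorph X X)}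

theorem isGreatest_apply (hH : ∀ m ∈ H, StrictMono m) {m : Homeomorph X X} (hm : m ∈ H)
    {x p : X} (hp : IsGreatest (fixedSet H ∩ Iic x) p) :
    IsGreatest (fixedSet H ∩ Iic (m x)) p := by
  have h : fixedSet H ∩ Iic (m x) = fixedSet H ∩ Iic x := by
    ext y
    refine and_congr_right fun hy => ?_
    conv_lhs => rw [← hy m hm]
    exact (hH m hm).le_iff_le
  rwa [h]

/-- A map in a group of increasing homeomorphisms can push `a` beyond `b` unless a global fixed
point separates them. -/
theorem exists_lt_apply [OrderTopology X] [CompactSpace X] (hH : ∀ m ∈ H, StrictMono m) {a b : X}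
    (hF : ∀ s ∈ fixedSet H, a ≤ s → b < s) : ∃ k ∈ H, b < k a := by
  by_contra! hcon
  let O : Set X := {y | ∃ m ∈ H, m a = y}
  have haO : a ∈ O := ⟨1, H.one_mem, rfl⟩
  obtain ⟨s, hsO, hs⟩ :=
    (isClosed_closure (s := O)).isCompact.exists_isGreatest ⟨a, subset_closure haO⟩
  have hle : ∀ m ∈ H, m s ≤ s := fun m hm => hs <| by
    refine map_mem_closure m.continuous hsO ?_
    rintro _ ⟨n, hn, rfl⟩
    exact ⟨m * n, H.mul_mem hm hn, rfl⟩
  have hfix : s ∈ fixedSet H := fun m hm => (hle m hm).antisymm <| by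
    have := (hH m hm).monotone (hle _ (H.inv_mem hm))
    rwa [apply_inv_self] at this
  have hsb : s ≤ b := by
    refine closure_minimal ?_ isClosed_Iic hsO
    rintro _ ⟨n, hn, rfl⟩
    exact hcon n hn
  exact (hF s hfix (hs (subset_closure haO))).not_ge hsb

end Order

section FreeAbelian

variable {X : Type*} [TopologicalSpace X] [LinearOrder X]

/-- Commuting increasing homeomorphisms, nontrivial on an invariant set `D` and with pairwise
disjoint supports within `D`, generate a free abelian group. -/
theorem exists_injective_hom {H : Subgroup (Homeomorph X X)} {D : Set X}
    (hD : ∀ m ∈ H, ∀ y ∈ D, m y ∈ D) (u : ℕ → Homeomorph X X) (huH : ∀ i, u i ∈ H)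
    (hmono : ∀ i, StrictMono (u i)) (hcomm : ∀ i j, u i * u j = u j * u i)
    (hdisj : ∀ i j, i ≠ j → ∀ y ∈ D, u i y = y ∨ u j y = y)
    (hne : ∀ i, ∃ y ∈ D, u i y ≠ y) :
    ∃ φ : Multiplicative (ℕ →₀ ℤ) →* Homeomorph X X,
      Function.Injective φ ∧ ∀ x, φ x ∈ H := by
  have : IsMulCommutative (Subgroup.closure (range u)) :=
    Subgroup.isMulCommutative_closure (by rintro _ ⟨i, rfl⟩ _ ⟨j, rfl⟩; exact hcomm i j)
  let v : ℕ → Subgroup.closure (range u) := fun i => ⟨u i, Subgroup.subset_closure ⟨i, rfl⟩⟩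
  let ψ : (ℕ →₀ ℤ) →+ Additive (Subgroup.closure (range u)) :=
    Finsupp.liftAddHom fun i => zmultiplesHom _ (Additive.ofMul (v i))
  let φ : Multiplicative (ℕ →₀ ℤ) →* Homeomorph X X :=
    (Subgroup.closure (range u)).subtype.comp (AddMonoidHom.toMultiplicativeLeft ψ)
  have hsingle : ∀ i n, φ (Multiplicative.ofAdd (Finsupp.single i n)) = u i ^ n := by
    intro i n
    have : ψ (Finsupp.single i n) = n • Additive.ofMul (v i) := by simp [ψ]
    change ((ψ (Finsupp.single i n)).toMul : Homeomorph X X) = _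
    rw [this]
    rfl
  have hact : ∀ (j : ℕ) (x : ℕ →₀ ℤ), ∀ y ∈ D, u j y ≠ y →
      φ (Multiplicative.ofAdd x) y = (u j ^ (x j)) y := by
    intro j x
    induction x using Finsupp.induction_linear with
    | zero => intro y _ _; simp
    | add x x' ih ih' =>
      intro y hy hjy
      rw [ofAdd_add, map_mul, mul_apply, ih' y hy hjy, ih, Finsupp.add_apply, zpow_add, mul_apply]
      · exact hD _ (H.zpow_mem (huH j) _) y hy
      · intro h
        apply hjy
        have h' : (u j * u j ^ (x' j)) y = (u j ^ (x' j)) y := h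
        rw [← zpow_one_add, add_comm, zpow_add_one, mul_apply] at h'
        exact (u j ^ (x' j)).injective h'
    | single i n =>
      intro y hy hjy
      rw [hsingle]
      by_cases hij : i = j
      · subst hij; simp
      · rw [zpow_apply_eq_self ((hdisj i j hij y hy).resolve_right hjy),
          Finsupp.single_eq_of_ne (Ne.symm hij), zpow_zero, one_apply]
  refine ⟨φ, (injective_iff_map_eq_one φ).2 fun x hx => ?_, fun x => ?_⟩
  · refine Multiplicative.toAdd.injective (Finsupp.ext fun j => ?_)
    obtain ⟨y, hy, hjy⟩ := hne j
    have := hact j x.toAdd y hy hjy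
    rw [ofAdd_toAdd, hx, one_apply] at this
    exact eq_zero_of_zpow_apply_eq (hmono j) hjy this.symm
  · refine (Subgroup.closure_le H).2 ?_ (SetLike.coe_mem (AddMonoidHom.toMultiplicativeLeft ψ x))
    rintro _ ⟨i, rfl⟩
    exact huH i

end FreeAbelian

section Core

variable {X : Type*} [TopologicalSpace X] [LinearOrder X] [OrderTopology X] [CompactSpace X]
  {H : Subgroup (Homeomorph X X)}

theorem exists_isGreatest_fixedSet [OrderBot X] (hH : ∀ m ∈ H, StrictMono m) (x : X) :
    ∃ p, IsGreatest (fixedSet H ∩ Iic x) p := by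
  refine ((isClosed_fixedSet H).inter isClosed_Iic).isCompact.exists_isGreatest
    ⟨⊥, fun m hm => ?_, bot_le⟩
  refine le_antisymm ?_ bot_le
  calc m ⊥ ≤ m (m⁻¹ ⊥) := (hH m hm).monotone bot_le
    _ = ⊥ := apply_inv_self m ⊥

theorem exists_isLeast_fixedSet [OrderTop X] (hH : ∀ m ∈ H, StrictMono m) (x : X) :
    ∃ q, IsLeast (fixedSet H ∩ Ici x) q := by
  refine ((isClosed_fixedSet H).inter isClosed_Ici).isCompact.exists_isLeast
    ⟨⊤, fun m hm => ?_, le_top⟩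
  refine le_antisymm le_top ?_
  calc ⊤ = m (m⁻¹ ⊤) := (apply_inv_self m ⊤).symm
    _ ≤ m ⊤ := (hH m hm).monotone le_top

/-- The left endpoints of the components of the complement of the global fixed set that `h`
moves. -/
def activeEnds (H : Subgroup (Homeomorph X X)) (h : Homeomorph X X) : Set X :=
  {p | ∃ x, h x ≠ x ∧ IsGreatest (fixedSet H ∩ Iic x) p}

theorem exists_hom_of_finite_of_germ [BoundedOrder X] [DenselyOrdered X]
    (hH : ∀ m ∈ H, StrictMono m)
    (hfin : {p | ∃ x ∉ fixedSet H, IsGreatest (fixedSet H ∩ Iic x) p}.Finite)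
    (hgerm : ∀ m ∈ H, ∀ n ∈ H, ∀ p ∈ fixedSet H, ∀ᶠ x in 𝓝 p, (m * n * m⁻¹ * n⁻¹) x = x)
    (hne : ∃ m ∈ H, ∃ n ∈ H, m * n ≠ n * m) :
    ∃ φ : Multiplicative (ℕ →₀ ℤ) →* Homeomorph X X,
      Function.Injective φ ∧ ∀ x, φ x ∈ H := by
  let K : Set (Homeomorph X X) :=
    {h | h ∈ H ∧ h ≠ 1 ∧ ∀ p ∈ fixedSet H, ∀ᶠ x in 𝓝 p, h x = x}
  have hK : ∀ m ∈ H, ∀ n ∈ H, m * n ≠ n * m → m * n * m⁻¹ * n⁻¹ ∈ K := by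
    intro m hm n hn hmn
    refine ⟨H.mul_mem (H.mul_mem (H.mul_mem hm hn) (H.inv_mem hm)) (H.inv_mem hn), ?_,
      hgerm m hm n hn⟩
    rwa [Ne, mul_inv_eq_one, mul_inv_eq_iff_eq_mul]
  have hKne : K.Nonempty := by
    obtain ⟨m, hm, n, hn, hmn⟩ := hne
    exact ⟨_, hK m hm n hn hmn⟩
  -- A nontrivial map, trivial near the global fixed points, moving as few components as possible.
  obtain ⟨h, ⟨hhH, hh1, hhgerm⟩, hmin⟩ := exists_minimalFor_of_wellFoundedLT (· ∈ K)
    (fun h => (activeEnds H h).ncard) hKne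
  have hactfin : (activeEnds H h).Finite := hfin.subset <| by
    rintro p ⟨x, hx, hp⟩
    exact ⟨x, fun hxF => hx (hxF h hhH), hp⟩
  obtain ⟨x₀, hx₀⟩ : ∃ x, h x ≠ x := by
    by_contra! hall
    exact hh1 (Homeomorph.ext hall)
  have hx₀F : x₀ ∉ fixedSet H := fun hx => hx₀ (hx h hhH)
  obtain ⟨p, hp⟩ := exists_isGreatest_fixedSet hH x₀
  obtain ⟨q, hq⟩ := exists_isLeast_fixedSet hH x₀
  have hpx : p < x₀ := lt_of_le_of_ne hp.1.2 fun e => hx₀F (e ▸ hp.1.1)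
  have hxq : x₀ < q := lt_of_le_of_ne hq.1.2 fun e => hx₀F (e ▸ hq.1.1)
  obtain ⟨a', hpa', ha'⟩ := (mem_nhdsGE_iff_exists_Ico_subset' hpx).1
    (mem_nhdsWithin_of_mem_nhds (hhgerm p hp.1.1))
  obtain ⟨b', hbq', hb'⟩ := (mem_nhdsLE_iff_exists_Ioc_subset' hxq).1
    (mem_nhdsWithin_of_mem_nhds (hhgerm q hq.1.1))
  obtain ⟨a, hpa, haa'⟩ := exists_between hpa'
  obtain ⟨b, hbb', hbq⟩ := exists_between hbq'
  have ha : Icc p a ⊆ {x | h x = x} := fun y hy => ha' ⟨hy.1, hy.2.trans_lt haa'⟩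
  have hb : Icc b q ⊆ {x | h x = x} := fun y hy => hb' ⟨hbb'.trans_le hy.1, hy.2⟩
  have hax : a < x₀ := by
    by_contra! hle
    exact hx₀ (ha ⟨hpx.le, hle⟩)
  have hxb : x₀ < b := by
    by_contra! hle
    exact hx₀ (hb ⟨hle, hxq.le⟩)
  obtain ⟨k, hkH, hk⟩ : ∃ k ∈ H, b < k a := by
    refine exists_lt_apply hH fun s hs has => ?_
    rcases le_total s x₀ with hsx | hsx
    · exact absurd (hp.2 ⟨hs, hsx⟩) (not_le.2 (lt_of_lt_of_le hpa has))
    · exact lt_of_lt_of_le hbq (hq.2 ⟨hs, hsx⟩)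
  let D : Set X := {y | IsGreatest (fixedSet H ∩ Iic y) p}
  have hD : ∀ m ∈ H, ∀ y ∈ D, m y ∈ D := fun m hm y hy => isGreatest_apply hH hm hy
  have hsupp : ∀ y ∈ D, h y ≠ y → a < y ∧ y < b := by
    intro y hy hhy
    have hpy : p ≤ y := hy.1.2
    have hyq : y < q := by
      by_contra! hle
      exact (hpx.trans hxq).not_ge (hy.2 ⟨hq.1.1, hle⟩)
    constructor
    · by_contra! hle
      exact hhy (ha ⟨hpy, hle⟩)
    · by_contra! hle
      exact hhy (hb ⟨hle, hyq.le⟩)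
  have hpow : ∀ n : ℕ, b < (k ^ (n + 1)) a := by
    intro n
    induction n with
    | zero => simpa using hk
    | succ n ih =>
      rw [pow_succ', mul_apply]
      exact hk.trans (hH k hkH ((hax.trans hxb).trans ih))
  let u : ℕ → Homeomorph X X := fun i => k ^ i * h * (k ^ i)⁻¹
  have hkpow : ∀ i : ℕ, k ^ i ∈ H := fun i => H.pow_mem hkH i
  have huH : ∀ i, u i ∈ H := fun i =>
    H.mul_mem (H.mul_mem (hkpow i) hhH) (H.inv_mem (hkpow i))
  have hufix : ∀ i y, h ((k ^ i)⁻¹ y) = (k ^ i)⁻¹ y → u i y = y := by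
    intro i y hy
    change (k ^ i) (h ((k ^ i)⁻¹ y)) = y
    rw [hy, apply_inv_self]
  have hu_add : ∀ i n, u (i + n) = k ^ i * u n * (k ^ i)⁻¹ := by
    intro i n
    simp only [u, pow_add, mul_inv_rev, mul_assoc]
  have hdisj₀ : ∀ n, ∀ y ∈ D, h y = y ∨ u (n + 1) y = y := by
    intro n y hy
    by_contra! hcon
    obtain ⟨h1, h2⟩ := hcon
    have hlt := (hsupp y hy h1).2
    have hgt := (hsupp _ (hD _ (H.inv_mem (hkpow (n + 1))) y hy) (mt (hufix _ y) h2)).1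
    have := hH _ (hkpow (n + 1)) hgt
    rw [apply_inv_self] at this
    exact lt_asymm hlt ((hpow n).trans this)
  have hcomm₀ : ∀ n, h * u (n + 1) = u (n + 1) * h := by
    intro n
    by_contra hcon
    have hcK := hK _ hhH _ (huH (n + 1)) hcon
    have hsub : activeEnds H (h * u (n + 1) * h⁻¹ * (u (n + 1))⁻¹) ⊆ activeEnds H h := by
      rintro r ⟨x, hx, hr⟩
      by_contra hrA
      apply hx
      have hfix : ∀ m ∈ H, h (m x) = m x := by
        intro m hm
        by_contra hmx
        exact hrA ⟨m x, hmx, isGreatest_apply hH hm hr⟩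
      have hux : u (n + 1) x = x := hufix _ x (hfix _ (H.inv_mem (hkpow _)))
      have hhx : h x = x := hfix 1 H.one_mem
      simp only [mul_apply, inv_apply_eq_self hux, inv_apply_eq_self hhx, hux, hhx]
    have hpn : p ∉ activeEnds H (h * u (n + 1) * h⁻¹ * (u (n + 1))⁻¹) := by
      rintro ⟨x, hx, hxD⟩
      apply hx
      have hy : (u (n + 1) * h)⁻¹ x ∈ D :=
        hD _ (H.inv_mem (H.mul_mem (huH _) hhH)) x hxD
      have := commute_on (hD h hhH) (hD _ (huH (n + 1))) (hdisj₀ n) hy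
      rw [mul_assoc, ← mul_inv_rev]
      exact this.trans (apply_inv_self (u (n + 1) * h) x)
    have hlt := ncard_lt_ncard (hsub.ssubset_of_mem_notMem ⟨x₀, hx₀, hp⟩ hpn) hactfin
    exact (hmin hcK hlt.le).not_gt hlt
  have hcomm_lt : ∀ i n, u i * u (i + (n + 1)) = u (i + (n + 1)) * u i := by
    intro i n
    have h0 : u i = k ^ i * h * (k ^ i)⁻¹ := rfl
    calc u i * u (i + (n + 1)) = k ^ i * (h * u (n + 1)) * (k ^ i)⁻¹ := by
          rw [hu_add i (n + 1), h0]; simp only [mul_assoc, inv_mul_cancel_left]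
      _ = k ^ i * (u (n + 1) * h) * (k ^ i)⁻¹ := by rw [hcomm₀]
      _ = u (i + (n + 1)) * u i := by rw [hu_add i (n + 1), h0]; simp only [mul_assoc, inv_mul_cancel_left]
  have hdisj_lt : ∀ i n, ∀ y ∈ D, u i y = y ∨ u (i + (n + 1)) y = y := by
    intro i n y hy
    refine (hdisj₀ n _ (hD _ (H.inv_mem (hkpow i)) y hy)).imp (hufix i y) fun h' => ?_
    rw [hu_add]
    change (k ^ i) (u (n + 1) ((k ^ i)⁻¹ y)) = y
    rw [h', apply_inv_self]
  refine exists_injective_hom hD u huH (fun i => hH _ (huH i)) ?_ ?_ ?_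
  · intro i j
    rcases lt_trichotomy i j with hij | rfl | hij
    · obtain ⟨n, rfl⟩ := Nat.exists_eq_add_of_lt hij
      exact hcomm_lt i n
    · rfl
    · obtain ⟨n, rfl⟩ := Nat.exists_eq_add_of_lt hij
      exact (hcomm_lt j n).symm
  · intro i j hne y hy
    rcases hne.lt_or_gt with hij | hij
    · obtain ⟨n, rfl⟩ := Nat.exists_eq_add_of_lt hij
      exact hdisj_lt i n y hy
    · obtain ⟨n, rfl⟩ := Nat.exists_eq_add_of_lt hij
      exact (hdisj_lt j n y hy).symm
  · intro i
    refine ⟨(k ^ i) x₀, hD _ (hkpow i) x₀ hp, fun hfix => hx₀ ?_⟩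
    have : (k ^ i) (h ((k ^ i)⁻¹ ((k ^ i) x₀))) = (k ^ i) x₀ := hfix
    rw [inv_apply_self] at this
    exact (k ^ i).injective this

end Core

section Germ

variable {f g : Homeomorph UnitInt UnitInt}

/-- Along the filter `l`, the map `m` is affine fixing `p`. -/
def IsAffineGerm (p : UnitInt) (l : Filter UnitInt) (m : Homeomorph UnitInt UnitInt) : Prop :=
  Tendsto m l l ∧ Tendsto ⇑m⁻¹ l l ∧ m p = p ∧
    ∃ c : ℝ, ∀ᶠ x in l, (m x : ℝ) = p + c * (x - p)

variable {p : UnitInt} {l : Filter UnitInt}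

theorem eventually_mul_apply {a b : Homeomorph UnitInt UnitInt} (hb : Tendsto b l l) {c d : ℝ}
    (ha : ∀ᶠ x in l, (a x : ℝ) = p + c * (x - p)) (hbd : ∀ᶠ x in l, (b x : ℝ) = p + d * (x - p)) :
    ∀ᶠ x in l, ((a * b) x : ℝ) = p + (c * d) * (x - p) := by
  filter_upwards [hb.eventually ha, hbd] with x h1 h2
  rw [mul_apply, h1, h2]
  ring

theorem IsAffineGerm.one : IsAffineGerm p l 1 :=
  ⟨tendsto_id, tendsto_id, rfl, 1, Eventually.of_forall fun x => by rw [one_apply]; ring⟩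

theorem IsAffineGerm.mul {a b : Homeomorph UnitInt UnitInt} (ha : IsAffineGerm p l a)
    (hb : IsAffineGerm p l b) : IsAffineGerm p l (a * b) := by
  obtain ⟨ha1, ha2, hap, c, hc⟩ := ha
  obtain ⟨hb1, hb2, hbp, d, hd⟩ := hb
  refine ⟨ha1.comp hb1, ?_, by rw [mul_apply, hbp, hap], c * d, eventually_mul_apply hb1 hc hd⟩
  rw [mul_inv_rev]
  exact hb2.comp ha2

theorem IsAffineGerm.inv {a : Homeomorph UnitInt UnitInt} (ha : IsAffineGerm p l a) :
    IsAffineGerm p l a⁻¹ := by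
  obtain ⟨ha1, ha2, hap, c, hc⟩ := ha
  refine ⟨ha2, by rwa [inv_inv], inv_apply_eq_self hap, c⁻¹, ?_⟩
  filter_upwards [ha2.eventually hc] with x hx
  rw [apply_inv_self] at hx
  by_cases h0 : c = 0
  · have hxp : x = p := Subtype.ext (by rw [hx, h0]; ring)
    rw [hxp, inv_apply_eq_self hap]
    ring
  · rw [hx]
    field_simp
    ring

theorem IsAffineGerm.commutator {a b : Homeomorph UnitInt UnitInt} (ha : IsAffineGerm p l a)
    (hb : IsAffineGerm p l b) : ∀ᶠ x in l, (a * b * a⁻¹ * b⁻¹) x = x := by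
  obtain ⟨c, hc⟩ := ha.2.2.2
  obtain ⟨d, hd⟩ := hb.2.2.2
  have h : ∀ᶠ x in l, (a * b) x = (b * a) x := by
    filter_upwards [eventually_mul_apply hb.1 hc hd, eventually_mul_apply ha.1 hd hc] with x h1 h2
    exact Subtype.ext (by rw [h1, h2]; ring)
  filter_upwards [(hb.mul ha).2.1.eventually h] with x hx
  rw [apply_inv_self] at hx
  rwa [mul_assoc, ← mul_inv_rev]

theorem tendsto_nhdsGE {a : Homeomorph UnitInt UnitInt} (ha : StrictMono a) (hp : a p = p) :
    Tendsto a (𝓝[≥] p) (𝓝[≥] p) := by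
  have h := a.continuous.continuousWithinAt.tendsto_nhdsWithin (s := Ici p) (x := p) (t := Ici p)
    fun x hx => by rw [mem_Ici, ← hp]; exact ha.monotone hx
  rwa [hp] at h

theorem tendsto_nhdsLE {a : Homeomorph UnitInt UnitInt} (ha : StrictMono a) (hp : a p = p) :
    Tendsto a (𝓝[≤] p) (𝓝[≤] p) := by
  have h := a.continuous.continuousWithinAt.tendsto_nhdsWithin (s := Iic p) (x := p) (t := Iic p)
    fun x hx => by rw [mem_Iic, ← hp]; exact ha.monotone hx
  rwa [hp] at h

theorem exists_piece_right {k : ℕ} {t : Fin (k + 1) → ℝ} (h0 : t 0 = 0)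
    (h1 : t (Fin.last k) = 1) {x : ℝ} (hx0 : 0 ≤ x) (hx1 : x < 1) :
    ∃ i : Fin k, t i.castSucc ≤ x ∧ x < t i.succ := by
  by_contra! hcon
  have : ∀ i, t i ≤ x := fun i => Fin.induction (by rwa [h0]) hcon i
  exact (h1 ▸ this (Fin.last k)).not_gt hx1

theorem exists_piece_left {k : ℕ} {t : Fin (k + 1) → ℝ} (h0 : t 0 = 0)
    (h1 : t (Fin.last k) = 1) {x : ℝ} (hx0 : 0 < x) (hx1 : x ≤ 1) :
    ∃ i : Fin k, t i.castSucc < x ∧ x ≤ t i.succ := by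
  by_contra! hcon
  have : ∀ i, t i < x := fun i => Fin.induction (by rwa [h0]) hcon i
  exact (h1 ▸ this (Fin.last k)).not_ge hx1

theorem eventually_affine_right (hf : IsPLHomeo f) (hp : f p = p) :
    ∃ c : ℝ, ∀ᶠ x in 𝓝[≥] p, (f x : ℝ) = p + c * (x - p) := by
  obtain ⟨-, k, t, h0, h1, -, hpc⟩ := hf
  rcases p.2.2.lt_or_eq with hlt | heq
  · obtain ⟨i, hi1, hi2⟩ := exists_piece_right h0 h1 p.2.1 hlt
    obtain ⟨a, b, hab⟩ := hpc i
    have hpab := hab p ⟨hi1, hi2.le⟩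
    rw [hp] at hpab
    refine ⟨a, ?_⟩
    have hev : ∀ᶠ x : UnitInt in 𝓝[≥] p, (x : ℝ) < t i.succ :=
      mem_nhdsWithin_of_mem_nhds (continuous_subtype_val.continuousAt.eventually_lt_const hi2)
    filter_upwards [hev, self_mem_nhdsWithin] with x hx hpx
    rw [hab x ⟨hi1.trans hpx, hx.le⟩]
    linarith
  · refine ⟨0, ?_⟩
    filter_upwards [self_mem_nhdsWithin] with x hpx
    have hxp : x = p := le_antisymm (Subtype.coe_le_coe.1 (x.2.2.trans_eq heq.symm)) hpx
    rw [hxp, hp]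
    ring

theorem eventually_affine_left (hf : IsPLHomeo f) (hp : f p = p) :
    ∃ c : ℝ, ∀ᶠ x in 𝓝[≤] p, (f x : ℝ) = p + c * (x - p) := by
  obtain ⟨-, k, t, h0, h1, -, hpc⟩ := hf
  rcases p.2.1.lt_or_eq with hlt | heq
  · obtain ⟨i, hi1, hi2⟩ := exists_piece_left h0 h1 hlt p.2.2
    obtain ⟨a, b, hab⟩ := hpc i
    have hpab := hab p ⟨hi1.le, hi2⟩
    rw [hp] at hpab
    refine ⟨a, ?_⟩
    have hev : ∀ᶠ x : UnitInt in 𝓝[≤] p, t i.castSucc < (x : ℝ) :=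
      mem_nhdsWithin_of_mem_nhds (continuous_subtype_val.continuousAt.eventually_const_lt hi1)
    filter_upwards [hev, self_mem_nhdsWithin] with x hx hpx
    rw [hab x ⟨hx.le, le_trans (Subtype.coe_le_coe.2 hpx) hi2⟩]
    linarith
  · refine ⟨0, ?_⟩
    filter_upwards [self_mem_nhdsWithin] with x hpx
    have hxp : x = p := le_antisymm hpx (Subtype.coe_le_coe.1 (heq.symm.trans_le x.2.1))
    rw [hxp, hp]
    ring

theorem isAffineGerm_right (hf : IsPLHomeo f) (hp : f p = p) : IsAffineGerm p (𝓝[≥] p) f :=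
  ⟨tendsto_nhdsGE hf.1 hp, tendsto_nhdsGE (inv_strictMono hf.1) (inv_apply_eq_self hp), hp,
    eventually_affine_right hf hp⟩

theorem isAffineGerm_left (hf : IsPLHomeo f) (hp : f p = p) : IsAffineGerm p (𝓝[≤] p) f :=
  ⟨tendsto_nhdsLE hf.1 hp, tendsto_nhdsLE (inv_strictMono hf.1) (inv_apply_eq_self hp), hp,
    eventually_affine_left hf hp⟩

theorem isAffineGerm_of_mem_closure (hf : IsAffineGerm p l f) (hg : IsAffineGerm p l g)
    {m : Homeomorph UnitInt UnitInt} (hm : m ∈ Subgroup.closure {f, g}) :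
    IsAffineGerm p l m := by
  induction hm using Subgroup.closure_induction with
  | mem m hm => rcases hm with rfl | rfl <;> assumption
  | one => exact .one
  | mul a b _ _ ha hb => exact ha.mul hb
  | inv a _ ha => exact ha.inv

theorem strictMono_of_mem_closure (hf : StrictMono f) (hg : StrictMono g)
    {m : Homeomorph UnitInt UnitInt} (hm : m ∈ Subgroup.closure {f, g}) : StrictMono m := by
  induction hm using Subgroup.closure_induction with
  | mem m hm => rcases hm with rfl | rfl <;> assumption
  | one => exact strictMono_id
  | mul a b _ _ ha hb => exact ha.comp hb
  | inv a _ ha => exact inv_strictMono ha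

theorem mem_fixedSet_closure {x : UnitInt} (hf : f x = x) (hg : g x = x) :
    x ∈ fixedSet (Subgroup.closure {f, g}) := by
  intro m hm
  induction hm using Subgroup.closure_induction with
  | mem m hm => rcases hm with rfl | rfl <;> assumption
  | one => rfl
  | mul a b _ _ ha hb => rw [mul_apply, hb, ha]
  | inv a _ ha => exact inv_apply_eq_self ha

/-- An affine map with two fixed points is the identity. -/
theorem apply_eq_self_of_affine {a b : ℝ} {s : Set ℝ} (hs : s.OrdConnected)
    (h : ∀ x : UnitInt, (x : ℝ) ∈ s → (f x : ℝ) = a * x + b) {p r x : UnitInt}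
    (hps : (p : ℝ) ∈ s) (hrs : (r : ℝ) ∈ s) (hp : f p = p) (hr : f r = r) (hpr : p < r)
    (hx : x ∈ Icc p r) : f x = x := by
  have h1 := h p hps
  have h2 := h r hrs
  rw [hp] at h1
  rw [hr] at h2
  have h3 := h x (hs.out hps hrs hx)
  have hpr' : (p : ℝ) < r := hpr
  have ha : a = 1 := by
    have : (a - 1) * ((r : ℝ) - p) = 0 := by linarith
    rcases mul_eq_zero.1 this with h | h <;> linarith
  subst ha
  exact Subtype.ext (by linarith)

theorem finite_left_ends (hf : IsPLHomeo f) (hg : IsPLHomeo g) :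
    {p | ∃ x ∉ fixedSet (Subgroup.closure {f, g}),
      IsGreatest (fixedSet (Subgroup.closure {f, g}) ∩ Iic x) p}.Finite := by
  obtain ⟨-, k, t, ht0, ht1, -, ht⟩ := hf
  obtain ⟨-, k', t', ht0', ht1', -, ht'⟩ := hg
  set F := fixedSet (Subgroup.closure {f, g}) with hF
  have hfF : ∀ x ∈ F, f x = x := fun x hx => hx f (Subgroup.subset_closure (by simp))
  have hgF : ∀ x ∈ F, g x = x := fun x hx => hx g (Subgroup.subset_closure (by simp))
  have hpiece : ∀ p : {p : UnitInt // ∃ x ∉ F, IsGreatest (F ∩ Iic x) p},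
      ∃ ij : Fin k × Fin k',
        (t ij.1.castSucc ≤ p.1 ∧ (p.1 : ℝ) < t ij.1.succ) ∧
        (t' ij.2.castSucc ≤ p.1 ∧ (p.1 : ℝ) < t' ij.2.succ) := by
    rintro ⟨p, x, hxF, hp⟩
    have hpx : p < x := lt_of_le_of_ne hp.1.2 fun e => hxF (e ▸ hp.1.1)
    have hp1 : (p : ℝ) < 1 := lt_of_lt_of_le (Subtype.coe_lt_coe.2 hpx) x.2.2
    obtain ⟨i, hi⟩ := exists_piece_right ht0 ht1 p.2.1 hp1
    obtain ⟨j, hj⟩ := exists_piece_right ht0' ht1' p.2.1 hp1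
    exact ⟨(i, j), hi, hj⟩
  choose ι hι using hpiece
  have hle : ∀ p r, ι p = ι r → r.1 ≤ p.1 := by
    intro p r hpr
    by_contra! hlt
    obtain ⟨x, hxF, hp⟩ := p.2
    have hrF : r.1 ∈ F := r.2.choose_spec.2.1.1
    have hpx : p.1 ≤ x := hp.1.2
    rcases le_total r.1 x with hrx | hxr
    · exact (hp.2 ⟨hrF, hrx⟩).not_gt hlt
    · have h1 := hι p
      have h2 := hι r
      rw [← hpr] at h2
      obtain ⟨a, b, hab⟩ := ht (ι p).1
      obtain ⟨a', b', hab'⟩ := ht' (ι p).2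
      refine hxF (mem_fixedSet_closure ?_ ?_)
      · exact apply_eq_self_of_affine ordConnected_Icc hab ⟨h1.1.1, h1.1.2.le⟩
          ⟨h2.1.1, h2.1.2.le⟩ (hfF _ hp.1.1) (hfF _ hrF) hlt ⟨hpx, hxr⟩
      · exact apply_eq_self_of_affine ordConnected_Icc hab' ⟨h1.2.1, h1.2.2.le⟩
          ⟨h2.2.1, h2.2.2.le⟩ (hgF _ hp.1.1) (hgF _ hrF) hlt ⟨hpx, hxr⟩
  have hinj : Function.Injective ι := fun p r hpr =>
    Subtype.ext ((hle r p hpr.symm).antisymm (hle p r hpr))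
  exact Finite.of_injective ι hinj

end Germ

end PLHomeo

/-- **Brin–Squier.** For any `f, g ∈ PL(I)`, the subgroup generated by `f` and `g` is
either abelian or contains a subgroup isomorphic to the free abelian group of countably
infinite rank `⨁_{i ∈ ℕ} ℤ`. -/
theorem plI_two_generated_abelian_or_contains_Zinfty
    (f g : Homeomorph UnitInt UnitInt) (hf : IsPLHomeo f) (hg : IsPLHomeo g) :
    (∀ a ∈ Subgroup.closure {f, g}, ∀ b ∈ Subgroup.closure {f, g}, a * b = b * a) ∨
      ∃ φ : Multiplicative (ℕ →₀ ℤ) →* Homeomorph UnitInt UnitInt,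
        Function.Injective φ ∧ ∀ x, φ x ∈ Subgroup.closure {f, g} := by
  refine or_iff_not_imp_left.2 fun hne => ?_
  push Not at hne
  refine PLHomeo.exists_hom_of_finite_of_germ
    (fun m hm => PLHomeo.strictMono_of_mem_closure hf.1 hg.1 hm)
    (PLHomeo.finite_left_ends hf hg) (fun m hm n hn p hp => ?_) hne
  have hfp : f p = p := hp f (Subgroup.subset_closure (by simp))
  have hgp : g p = p := hp g (Subgroup.subset_closure (by simp))
  have hl := fun {m} hm => PLHomeo.isAffineGerm_of_mem_closure (m := m)
    (PLHomeo.isAffineGerm_left hf hfp) (PLHomeo.isAffineGerm_left hg hgp) hm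
  have hr := fun {m} hm => PLHomeo.isAffineGerm_of_mem_closure (m := m)
    (PLHomeo.isAffineGerm_right hf hfp) (PLHomeo.isAffineGerm_right hg hgp) hm
  rw [← nhdsLE_sup_nhdsGE, Filter.eventually_sup]
  exact ⟨(hl hm).commutator (hl hn), (hr hm).commutator (hr hn)⟩
end

section
/- For every n ≥ 1, the group PL(Iⁿ, F) contains no subgroup isomorphic to the free group of rank 2. -/
/-- The unit cube `[0,1]ⁿ`. -/
abbrev Cube (n : ℕ) : Type := Set.Icc (0 : Fin n → ℝ) 1

/-- `f` is an orientation-preserving piecewise linear homeomorphism of the cube `[0,1]ⁿ`: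
there is a finite family of `n`-dimensional affine simplices (convex hulls of `n + 1`
affinely independent points) with pairwise disjoint interiors whose union is `[0,1]ⁿ`,
such that on each simplex `f` agrees with an affine map of `ℝⁿ` whose linear part has
positive determinant. -/
def IsPLCubeHomeo {n : ℕ} (f : Homeomorph (Cube n) (Cube n)) : Prop :=
  ∃ (k : ℕ) (p : Fin k → Fin (n + 1) → Fin n → ℝ)
    (A : Fin k → ((Fin n → ℝ) →ᵃ[ℝ] (Fin n → ℝ))),
      (∀ i, AffineIndependent ℝ (p i)) ∧
      (∀ i j, i ≠ j →
        interior (convexHull ℝ (Set.range (p i))) ∩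
          interior (convexHull ℝ (Set.range (p j))) = ∅) ∧
      (⋃ i, convexHull ℝ (Set.range (p i))) = Set.Icc (0 : Fin n → ℝ) 1 ∧
      (∀ i, 0 < LinearMap.det (A i).linear) ∧
      (∀ i, ∀ x : Cube n, (x : Fin n → ℝ) ∈ convexHull ℝ (Set.range (p i)) →
        (f x : Fin n → ℝ) = A i (x : Fin n → ℝ))

/-- Identifying `[0,1]ⁿ = [0,1]ⁿ⁻¹ × [0,1]`, the vertical line over the point whose first
`n - 1` coordinates are those of `c`: all points of the cube agreeing with `c` in every
coordinate except the last one. -/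
def VertLine {n : ℕ} (c : Fin n → ℝ) : Set (Cube n) :=
  {z | ∀ i : Fin n, (i : ℕ) + 1 < n → (z : Fin n → ℝ) i = c i}

open Filter
open scoped commutatorElement

/-- Nontrivial commuting elements have a common nontrivial power. -/
def CommutingPowersMeet (G : Type*) [Group G] : Prop :=
  ∀ u v : G, u ≠ 1 → v ≠ 1 → Commute u v → ∃ k l : ℤ, u ^ k = v ^ l ∧ u ^ k ≠ 1

theorem FreeGroup.not_commute_of {ι : Type*} {i j : ι} (h : i ≠ j) :
    ¬ Commute (FreeGroup.of i) (FreeGroup.of j) := by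
  classical
  intro hc
  have h2 := hc.map (FreeGroup.lift fun x : ι =>
    if x = i then Equiv.swap (0 : Fin 3) 1 else Equiv.swap (1 : Fin 3) 2)
  simp only [FreeGroup.lift_apply_of, if_true, if_neg h.symm] at h2
  revert h2
  unfold Commute SemiconjBy
  decide

theorem FreeGroup.commutingPowersMeet_of_subsingleton {ι : Type*} [Subsingleton ι] :
    CommutingPowersMeet (FreeGroup ι) := by
  intro u v hu hv _
  rcases isEmpty_or_nonempty ι with hι | ⟨⟨i⟩⟩
  · exact absurd (Subsingleton.elim u 1) hu
  have key : ∀ w : FreeGroup ι, ∃ k : ℤ, w = FreeGroup.of i ^ k := by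
    intro w
    induction w using FreeGroup.induction_on with
    | C1 => exact ⟨0, by simp⟩
    | of x => exact ⟨1, by simp [Subsingleton.elim x i]⟩
    | inv_of x _ => exact ⟨-1, by simp [Subsingleton.elim x i]⟩
    | mul x y hx hy =>
      obtain ⟨k, rfl⟩ := hx
      obtain ⟨l, rfl⟩ := hy
      exact ⟨k + l, (zpow_add _ _ _).symm⟩
  obtain ⟨k, rfl⟩ := key u
  obtain ⟨l, rfl⟩ := key v
  refine ⟨l, k, by rw [← zpow_mul, ← zpow_mul, mul_comm], fun h => hu ?_⟩
  have hl : l ≠ 0 := by rintro rfl; simp at hv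
  exact (IsMulTorsionFree.zpow_eq_one_iff_left hl).1 h

theorem CommutingPowersMeet.of_injective {G H : Type*} [Group G] [Group H]
    (hH : CommutingPowersMeet H) (f : G →* H) (hf : Function.Injective f) :
    CommutingPowersMeet G := by
  intro u v hu hv huv
  obtain ⟨k, l, h1, h2⟩ := hH (f u) (f v) ((map_ne_one_iff f hf).2 hu)
    ((map_ne_one_iff f hf).2 hv) (huv.map f)
  exact ⟨k, l, hf (by simpa using h1), fun h => h2 (by rw [← map_zpow, h, map_one])⟩

theorem FreeGroup.commutingPowersMeet (ι : Type*) : CommutingPowersMeet (FreeGroup ι) := by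
  intro u v hu hv huv
  let S : Subgroup (FreeGroup ι) := Subgroup.closure {u, v}
  have hS : ∀ x y : S, Commute x y := by
    have : IsMulCommutative S := Subgroup.isMulCommutative_closure (by
      rintro x (rfl | rfl) y (rfl | rfl)
      exacts [rfl, huv, huv.symm, rfl])
    exact fun x y => mul_comm' x y
  let e := IsFreeGroup.toFreeGroup S
  have : Subsingleton (IsFreeGroup.Generators S) := by
    refine ⟨fun i j => ?_⟩
    by_contra hij
    refine FreeGroup.not_commute_of hij ?_
    have := (hS (e.symm (FreeGroup.of i)) (e.symm (FreeGroup.of j))).map e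
    simpa using this
  have hSm : CommutingPowersMeet S :=
    FreeGroup.commutingPowersMeet_of_subsingleton.of_injective e.toMonoidHom e.injective
  have hu' : u ∈ S := Subgroup.subset_closure (by simp)
  have hv' : v ∈ S := Subgroup.subset_closure (by simp)
  obtain ⟨k, l, h1, h2⟩ := hSm ⟨u, hu'⟩ ⟨v, hv'⟩ (by simpa [Subtype.ext_iff] using hu)
    (by simpa [Subtype.ext_iff] using hv) (hS _ _)
  exact ⟨k, l, by simpa [Subtype.ext_iff] using h1, by simpa [Subtype.ext_iff] using h2⟩

section NormalSubgroups

variable {G : Type*} [Group G]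

theorem CommutingPowersMeet.inf_ne_bot (hG : CommutingPowersMeet G) {M N : Subgroup G}
    (hM : M.Normal) (hN : N.Normal) (hM' : M ≠ ⊥) (hN' : N ≠ ⊥) : M ⊓ N ≠ ⊥ := by
  obtain ⟨u, hu, hu1⟩ := M.bot_or_exists_ne_one.resolve_left hM'
  obtain ⟨v, hv, hv1⟩ := N.bot_or_exists_ne_one.resolve_left hN'
  intro hbot
  have hc : Commute u v := Subgroup.commute_of_normal_of_disjoint M N hM hN
    (disjoint_iff.2 hbot) u v hu hv
  obtain ⟨k, l, h1, h2⟩ := hG u v hu1 hv1 hc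
  refine h2 ((Subgroup.eq_bot_iff_forall _).1 hbot _ ⟨M.zpow_mem hu k, ?_⟩)
  exact h1 ▸ N.zpow_mem hv l

theorem CommutingPowersMeet.iInf_ne_bot (hG : CommutingPowersMeet G) (hG1 : ∃ g : G, g ≠ 1)
    {ι : Type*} [Finite ι] (N : ι → Subgroup G) (hN : ∀ i, (N i).Normal) (hN' : ∀ i, N i ≠ ⊥) :
    ⨅ i, N i ≠ ⊥ := by
  classical
  have := Fintype.ofFinite ι
  have key : ∀ s : Finset ι, (⨅ i ∈ s, N i) ≠ ⊥ := by
    intro s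
    induction s using Finset.induction_on with
    | empty =>
      obtain ⟨g, hg⟩ := hG1
      intro h
      exact hg ((Subgroup.eq_bot_iff_forall _).1 h g (by simp))
    | insert i s _ ih =>
      rw [Finset.iInf_insert]
      refine hG.inf_ne_bot (hN i) ?_ (hN' i) ih
      exact Subgroup.normal_iInf_normal fun i => Subgroup.normal_iInf_normal fun _ => hN i
  simpa using key Finset.univ

theorem fixingSubgroup_normal {X : Type*} [MulAction G X] {s : Set X}
    (hs : ∀ g : G, ∀ x ∈ s, g • x ∈ s) : (fixingSubgroup G s).Normal := by
  refine ⟨fun n hn g => ?_⟩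
  rw [mem_fixingSubgroup_iff] at hn ⊢
  intro y hy
  rw [mul_smul, mul_smul, hn _ (hs g⁻¹ y hy), smul_inv_smul]

end NormalSubgroups

section EventuallyAffine

variable {K : Type*} [Field K] {G : Type*} [Group G] [MulAction G K] {l : Filter K}

theorem eventually_affine_mul (hl : ∀ g : G, Tendsto (fun t : K => g • t) l l) {u v : G}
    {a b c d : K} (hu : ∀ᶠ t in l, u • t = a * t + b) (hv : ∀ᶠ t in l, v • t = c * t + d) :
    ∀ᶠ t in l, (u * v) • t = (a * c) * t + (a * d + b) := by
  filter_upwards [hv, (hl v).eventually hu] with t h1 h2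
  rw [mul_smul, h2, h1]
  ring

theorem eventually_affine_inv (hl : ∀ g : G, Tendsto (fun t : K => g • t) l l) {u : G}
    {a b : K} (ha : a ≠ 0) (hu : ∀ᶠ t in l, u • t = a * t + b) :
    ∀ᶠ t in l, u⁻¹ • t = a⁻¹ * t + -(a⁻¹ * b) := by
  filter_upwards [(hl u⁻¹).eventually hu] with t h
  rw [smul_inv_smul] at h
  nth_rewrite 2 [h]
  field_simp
  ring

theorem eventually_affine_commutator (hl : ∀ g : G, Tendsto (fun t : K => g • t) l l) {u v : G}
    {a b c d : K} (ha : a ≠ 0) (hc : c ≠ 0)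
    (hu : ∀ᶠ t in l, u • t = a * t + b) (hv : ∀ᶠ t in l, v • t = c * t + d) :
    ∀ᶠ t in l, ⁅u, v⁆ • t = 1 * t + (a * d + b - c * b - d) := by
  have h := eventually_affine_mul hl (eventually_affine_mul hl (eventually_affine_mul hl hu hv)
    (eventually_affine_inv hl ha hu)) (eventually_affine_inv hl hc hv)
  filter_upwards [h] with t ht
  rw [commutatorElement_def, ht]
  field_simp
  ring

/-- Affine maps form a metabelian group. -/
theorem eventually_commutator_commutator_smul (hl : ∀ g : G, Tendsto (fun t : K => g • t) l l)
    {u v : G} {a b c d : K} (ha : a ≠ 0) (hc : c ≠ 0)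
    (hu : ∀ᶠ t in l, u • t = a * t + b) (hv : ∀ᶠ t in l, v • t = c * t + d) :
    ∀ᶠ t in l, ⁅⁅u, v⁆, ⁅u, v⁻¹⁆⁆ • t = t := by
  have h := eventually_affine_commutator hl one_ne_zero one_ne_zero
    (eventually_affine_commutator hl ha hc hu hv)
    (eventually_affine_commutator hl ha (inv_ne_zero hc) hu (eventually_affine_inv hl hc hv))
  filter_upwards [h] with t ht
  rw [ht]
  ring

theorem exists_affine_slope_ne_zero {s : Set K} {u : G}
    (h : ∃ a b : K, ∀ t ∈ s, u • t = a * t + b) :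
    ∃ a b : K, a ≠ 0 ∧ ∀ t ∈ s, u • t = a * t + b := by
  obtain ⟨a, b, h⟩ := h
  by_cases ha : a = 0
  · rcases s.eq_empty_or_nonempty with rfl | ⟨t₀, ht₀⟩
    · exact ⟨1, 0, one_ne_zero, by simp⟩
    · refine ⟨1, u • t₀ - t₀, one_ne_zero, fun t ht => ?_⟩
      have : t = t₀ := MulAction.injective u (by
        change u • t = u • t₀
        rw [h t ht, h t₀ ht₀, ha, zero_mul, zero_mul])
      rw [this]
      ring
  · exact ⟨a, b, ha, h⟩

theorem eventually_commutator_commutator_smul_of_mem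
    (hl : ∀ g : G, Tendsto (fun t : K => g • t) l l) {u v : G} {s : Set K} (hs : s ∈ l)
    (hu : ∃ a b : K, ∀ t ∈ s, u • t = a * t + b) (hv : ∃ a b : K, ∀ t ∈ s, v • t = a * t + b) :
    ∀ᶠ t in l, ⁅⁅u, v⁆, ⁅u, v⁻¹⁆⁆ • t = t := by
  obtain ⟨a, b, ha, hu⟩ := exists_affine_slope_ne_zero hu
  obtain ⟨c, d, hc, hv⟩ := exists_affine_slope_ne_zero hv
  exact eventually_commutator_commutator_smul hl ha hc (eventually_of_mem hs hu)
    (eventually_of_mem hs hv)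

end EventuallyAffine

section OrbitHull

variable {K : Type*} [LinearOrder K] (G : Type*) [Group G] [MulAction G K]

/-- The convex hull of the orbit of a point. -/
def orbitHull (t : K) : Set K := {s | (∃ g : G, g • t ≤ s) ∧ ∃ g : G, s ≤ g • t}

variable {G} {s t : K}

theorem self_mem_orbitHull : t ∈ orbitHull G t :=
  ⟨⟨1, (one_smul G t).le⟩, ⟨1, (one_smul G t).ge⟩⟩

theorem ordConnected_orbitHull : (orbitHull G t).OrdConnected :=
  ⟨fun _ hx _ hy _ hz => ⟨hx.1.imp fun _ h => h.trans hz.1, hy.2.imp fun _ h => hz.2.trans h⟩⟩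

variable (hmono : ∀ g : G, Monotone fun t : K => g • t)
include hmono

theorem smul_mem_orbitHull (g : G) (hs : s ∈ orbitHull G t) : g • s ∈ orbitHull G t := by
  obtain ⟨⟨g₁, h₁⟩, ⟨g₂, h₂⟩⟩ := hs
  exact ⟨⟨g * g₁, by rw [mul_smul]; exact hmono g h₁⟩, ⟨g * g₂, by rw [mul_smul]; exact hmono g h₂⟩⟩

theorem mem_orbitHull_symm (hs : s ∈ orbitHull G t) : t ∈ orbitHull G s := by
  obtain ⟨⟨g₁, h₁⟩, ⟨g₂, h₂⟩⟩ := hs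
  refine ⟨⟨g₂⁻¹, ?_⟩, ⟨g₁⁻¹, ?_⟩⟩
  · simpa using hmono g₂⁻¹ h₂
  · simpa using hmono g₁⁻¹ h₁

theorem orbitHull_subset (hs : s ∈ orbitHull G t) : orbitHull G s ⊆ orbitHull G t := by
  rintro r ⟨⟨g₁, h₁⟩, ⟨g₂, h₂⟩⟩
  exact ordConnected_orbitHull.out (smul_mem_orbitHull hmono g₁ hs)
    (smul_mem_orbitHull hmono g₂ hs) ⟨h₁, h₂⟩

theorem orbitHull_eq (hs : s ∈ orbitHull G t) : orbitHull G s = orbitHull G t :=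
  (orbitHull_subset hmono hs).antisymm (orbitHull_subset hmono (mem_orbitHull_symm hmono hs))

/-- If a nontrivial element acts trivially near both ends of the hull of an orbit, then some
nontrivial element acts trivially on the whole hull. -/
theorem fixingSubgroup_orbitHull_ne_bot (hG : CommutingPowersMeet G) {h : G} (h1 : h ≠ 1)
    {p q : K} (hp : p ∈ orbitHull G t) (hq : q ∈ orbitHull G t)
    (hhp : ∀ r ∈ orbitHull G t, r ≤ p → h • r = r)
    (hhq : ∀ r ∈ orbitHull G t, q ≤ r → h • r = r) :
    fixingSubgroup G (orbitHull G t) ≠ ⊥ := by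
  obtain ⟨g, hg⟩ : ∃ g : G, q ≤ g • p := (orbitHull_eq hmono hp ▸ hq).2
  have hconj : ∀ r ∈ orbitHull G t, r ≤ q → h • g⁻¹ • r = g⁻¹ • r := fun r hr hrq =>
    hhp _ (smul_mem_orbitHull hmono _ hr) (by simpa using hmono g⁻¹ (hrq.trans hg))
  by_cases hc : Commute h (g * h * g⁻¹)
  · obtain ⟨k, l, h2, h3⟩ := hG h (g * h * g⁻¹) h1 (by simpa using h1) hc
    refine fun hbot => h3 ((Subgroup.eq_bot_iff_forall _).1 hbot _ ?_)
    rw [mem_fixingSubgroup_iff]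
    intro r hr
    rcases le_total r q with hrq | hrq
    · rw [h2, conj_zpow, mul_smul, mul_smul]
      have : h ^ l ∈ MulAction.stabilizer G (g⁻¹ • r) := zpow_mem (hconj r hr hrq) l
      rw [MulAction.mem_stabilizer_iff.1 this, smul_inv_smul]
    · have : h ^ k ∈ MulAction.stabilizer G r := zpow_mem (hhq r hr hrq) k
      exact this
  · refine fun hbot => hc (commutatorElement_eq_one_iff_commute.1
      ((Subgroup.eq_bot_iff_forall _).1 hbot _ ?_))
    rw [mem_fixingSubgroup_iff]
    set v := g * h * g⁻¹ with hv
    have hvfix : ∀ r ∈ orbitHull G t, r ≤ q → v • r = r := fun r hr hrq => by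
      rw [hv, mul_smul, mul_smul, hconj r hr hrq, smul_inv_smul]
    have huv : ∀ r ∈ orbitHull G t, (h * v) • r = (v * h) • r := by
      intro r hr
      rw [mul_smul h v, mul_smul v h]
      rcases le_total r q with hrq | hrq
      · rw [hvfix r hr hrq, hvfix _ (smul_mem_orbitHull hmono _ hr)]
        exact (hmono h hrq).trans (hhq q hq le_rfl).le
      · rw [hhq r hr hrq, hhq _ (smul_mem_orbitHull hmono _ hr)]
        exact (hvfix q hq le_rfl).ge.trans (hmono v hrq)
    intro r hr
    have := huv _ (smul_mem_orbitHull hmono (v * h)⁻¹ hr)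
    rw [smul_inv_smul, ← mul_smul] at this
    rw [commutatorElement_def]
    simpa [mul_assoc] using this

end OrbitHull

section Ends

variable {K : Type*} [LinearOrder K] {C : Set K}

theorem exists_mem_map_atTop [Nonempty C] {ι : Type*} [Finite ι] {J : ι → Set K}
    (hJ : ∀ i, (J i).OrdConnected) (hcov : ∀ t, ∃ i, t ∈ J i) :
    ∃ i, J i ∈ map ((↑) : C → K) atTop := by
  by_contra! hcon
  have key : ∀ i, ∀ᶠ t in map ((↑) : C → K) atTop, t ∉ J i := by
    intro i
    by_contra hf
    refine hcon i ?_
    rw [eventually_map, eventually_atTop] at hf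
    push Not at hf
    obtain ⟨s, _, hs⟩ := hf (Classical.arbitrary C)
    rw [mem_map, mem_atTop_sets]
    refine ⟨s, fun t ht => ?_⟩
    obtain ⟨r, hr, hr'⟩ := hf t
    exact (hJ i).out hs hr' ⟨ht, hr⟩
  obtain ⟨t, ht⟩ := (eventually_all.2 key).exists
  obtain ⟨i, hi⟩ := hcov t
  exact ht i hi

theorem exists_mem_map_atBot [Nonempty C] {ι : Type*} [Finite ι] {J : ι → Set K}
    (hJ : ∀ i, (J i).OrdConnected) (hcov : ∀ t, ∃ i, t ∈ J i) :
    ∃ i, J i ∈ map ((↑) : C → K) atBot := by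
  by_contra! hcon
  have key : ∀ i, ∀ᶠ t in map ((↑) : C → K) atBot, t ∉ J i := by
    intro i
    by_contra hf
    refine hcon i ?_
    rw [eventually_map, eventually_atBot] at hf
    push Not at hf
    obtain ⟨s, _, hs⟩ := hf (Classical.arbitrary C)
    rw [mem_map, mem_atBot_sets]
    refine ⟨s, fun t ht => ?_⟩
    obtain ⟨r, hr, hr'⟩ := hf t
    exact (hJ i).out hr' hs ⟨hr, ht⟩
  obtain ⟨t, ht⟩ := (eventually_all.2 key).exists
  obtain ⟨i, hi⟩ := hcov t
  exact ht i hi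

variable {G : Type*} [Group G] [MulAction G K]

theorem tendsto_smul_map_atTop (hmono : ∀ g : G, Monotone fun t : K => g • t)
    (hC : ∀ g : G, ∀ t ∈ C, g • t ∈ C) (g : G) :
    Tendsto (fun t : K => g • t) (map ((↑) : C → K) atTop) (map ((↑) : C → K) atTop) := by
  have h : Tendsto (fun t : C => (⟨g • (t : K), hC g t t.2⟩ : C)) atTop atTop :=
    tendsto_atTop.2 fun b => (eventually_ge_atTop ⟨g⁻¹ • (b : K), hC _ b b.2⟩).mono fun a ha => by
      simpa [← Subtype.coe_le_coe] using hmono g (Subtype.coe_le_coe.2 ha)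
  exact tendsto_map'_iff.2 (tendsto_map.comp h)

theorem tendsto_smul_map_atBot (hmono : ∀ g : G, Monotone fun t : K => g • t)
    (hC : ∀ g : G, ∀ t ∈ C, g • t ∈ C) (g : G) :
    Tendsto (fun t : K => g • t) (map ((↑) : C → K) atBot) (map ((↑) : C → K) atBot) := by
  have h : Tendsto (fun t : C => (⟨g • (t : K), hC g t t.2⟩ : C)) atBot atBot :=
    tendsto_atBot.2 fun b => (eventually_le_atBot ⟨g⁻¹ • (b : K), hC _ b b.2⟩).mono fun a ha => by
      simpa [← Subtype.coe_le_coe] using hmono g (Subtype.coe_le_coe.2 ha)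
  exact tendsto_map'_iff.2 (tendsto_map.comp h)

end Ends

section BrinSquier

variable {K : Type*} [LinearOrder K] {G : Type*} [Group G] [MulAction G K]
  (hmono : ∀ g : G, Monotone fun t : K => g • t)

/-- The points whose orbit hull crosses the upper boundary of `J`. -/
def crossingAbove (G : Type*) [Group G] [MulAction G K] (J : Set K) : Set K :=
  {t | ∃ s ∈ orbitHull G t, ∃ s' ∈ orbitHull G t, s ∈ J ∧ s' ∉ J ∧ s < s'}

/-- The points whose orbit hull crosses the lower boundary of `J`. -/
def crossingBelow (G : Type*) [Group G] [MulAction G K] (J : Set K) : Set K :=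
  {t | ∃ s ∈ orbitHull G t, ∃ s' ∈ orbitHull G t, s ∈ J ∧ s' ∉ J ∧ s' < s}

theorem fixingSubgroup_ne_bot_of_subset_orbitHull (hG : ∃ g : G, g ≠ 1)
    (hne : ∀ t : K, fixingSubgroup G (orbitHull G t) ≠ ⊥) {D : Set K}
    (hD : ∀ t ∈ D, D ⊆ orbitHull G t) : fixingSubgroup G D ≠ ⊥ := by
  rcases D.eq_empty_or_nonempty with rfl | ⟨t, ht⟩
  · obtain ⟨g, hg⟩ := hG
    intro h
    exact hg ((Subgroup.eq_bot_iff_forall _).1 h g (by simp))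
  · intro h
    exact hne t (le_bot_iff.1 (h ▸ fixingSubgroup_antitone G K (hD t ht)))

include hmono

theorem smul_mem_crossingAbove {J : Set K} (g : G) {t : K} (ht : t ∈ crossingAbove G J) :
    g • t ∈ crossingAbove G J := by
  unfold crossingAbove at ht ⊢
  rwa [Set.mem_ofPred_eq, orbitHull_eq hmono (smul_mem_orbitHull hmono g self_mem_orbitHull)]

theorem smul_mem_crossingBelow {J : Set K} (g : G) {t : K} (ht : t ∈ crossingBelow G J) :
    g • t ∈ crossingBelow G J := by
  unfold crossingBelow at ht ⊢
  rwa [Set.mem_ofPred_eq, orbitHull_eq hmono (smul_mem_orbitHull hmono g self_mem_orbitHull)]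

theorem mem_orbitHull_of_mem {s t r : K} (hs : r ∈ orbitHull G s) (ht : r ∈ orbitHull G t) :
    t ∈ orbitHull G s := by
  rw [← orbitHull_eq hmono hs, orbitHull_eq hmono ht]
  exact self_mem_orbitHull

theorem crossingAbove_subset {J : Set K} (hJ : J.OrdConnected) {t : K}
    (ht : t ∈ crossingAbove G J) : crossingAbove G J ⊆ orbitHull G t := by
  rintro r ⟨s₁, h₁, s₁', h₁', hs₁, hs₁', hlt₁⟩
  obtain ⟨s₂, h₂, s₂', h₂', hs₂, hs₂', hlt₂⟩ := ht
  have h12 : s₁ ≤ s₂' := by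
    by_contra! h
    exact hs₂' (hJ.out hs₂ hs₁ ⟨hlt₂.le, h.le⟩)
  have h21 : s₂ ≤ s₁' := by
    by_contra! h
    exact hs₁' (hJ.out hs₁ hs₂ ⟨hlt₁.le, h.le⟩)
  rcases le_total s₁ s₂ with h | h
  · exact mem_orbitHull_of_mem hmono h₂ (ordConnected_orbitHull.out h₁ h₁' ⟨h, h21⟩)
  · exact mem_orbitHull_of_mem hmono (ordConnected_orbitHull.out h₂ h₂' ⟨h, h12⟩) h₁

theorem crossingBelow_subset {J : Set K} (hJ : J.OrdConnected) {t : K}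
    (ht : t ∈ crossingBelow G J) : crossingBelow G J ⊆ orbitHull G t := by
  rintro r ⟨s₁, h₁, s₁', h₁', hs₁, hs₁', hlt₁⟩
  obtain ⟨s₂, h₂, s₂', h₂', hs₂, hs₂', hlt₂⟩ := ht
  have h12 : s₂' ≤ s₁ := by
    by_contra! h
    exact hs₂' (hJ.out hs₁ hs₂ ⟨h.le, hlt₂.le⟩)
  have h21 : s₁' ≤ s₂ := by
    by_contra! h
    exact hs₁' (hJ.out hs₂ hs₁ ⟨h.le, hlt₁.le⟩)
  rcases le_total s₁ s₂ with h | h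
  · exact mem_orbitHull_of_mem hmono (ordConnected_orbitHull.out h₂' h₂ ⟨h12, h⟩) h₁
  · exact mem_orbitHull_of_mem hmono h₂ (ordConnected_orbitHull.out h₁' h₁ ⟨h21, h⟩)

end BrinSquier

/-- Over an ordered field, a group of monotone maps in which commuting elements have common powers
cannot act faithfully if it contains two piecewise affine maps
which do not satisfy a certain metabelian law. -/
theorem exists_ne_one_forall_smul_eq {K : Type*} [Field K] [LinearOrder K]
    {G : Type*} [Group G] [MulAction G K]
    (hmono : ∀ g : G, Monotone fun t : K => g • t) (hG : CommutingPowersMeet G)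
    {u v : G} (huv : ⁅⁅u, v⁆, ⁅u, v⁻¹⁆⁆ ≠ 1) {ι : Type*} [Finite ι] {J : ι → Set K}
    (hJ : ∀ i, (J i).OrdConnected) (hcov : ∀ t, ∃ i, t ∈ J i)
    (hu : ∀ i, ∃ a b : K, ∀ t ∈ J i, u • t = a * t + b)
    (hv : ∀ i, ∃ a b : K, ∀ t ∈ J i, v • t = a * t + b) :
    ∃ g : G, g ≠ 1 ∧ ∀ t : K, g • t = t := by
  have hne : ∀ t : K, fixingSubgroup G (orbitHull G t) ≠ ⊥ := by
    intro t
    have hC : ∀ g : G, ∀ s ∈ orbitHull G t, g • s ∈ orbitHull G t :=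
      fun g s => smul_mem_orbitHull hmono g
    have : Nonempty (orbitHull G t) := ⟨⟨t, self_mem_orbitHull⟩⟩
    obtain ⟨i, hi⟩ := exists_mem_map_atBot (C := orbitHull G t) hJ hcov
    obtain ⟨j, hj⟩ := exists_mem_map_atTop (C := orbitHull G t) hJ hcov
    have hbot := eventually_commutator_commutator_smul_of_mem
      (tendsto_smul_map_atBot hmono hC) hi (hu i) (hv i)
    have htop := eventually_commutator_commutator_smul_of_mem
      (tendsto_smul_map_atTop hmono hC) hj (hu j) (hv j)
    rw [eventually_map, eventually_atBot] at hbot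
    rw [eventually_map, eventually_atTop] at htop
    obtain ⟨p, hp⟩ := hbot
    obtain ⟨q, hq⟩ := htop
    exact fixingSubgroup_orbitHull_ne_bot hmono hG huv p.2 q.2 (fun r hr => hp ⟨r, hr⟩)
      (fun r hr => hq ⟨r, hr⟩)
  have hG1 : ∃ g : G, g ≠ 1 := ⟨_, huv⟩
  let D : Option (ι × Bool) → Set K := fun
    | none => {t | ∃ i, orbitHull G t ⊆ J i}
    | some (i, true) => crossingAbove G (J i)
    | some (i, false) => crossingBelow G (J i)
  have hDinv : ∀ d, ∀ g : G, ∀ t ∈ D d, g • t ∈ D d := by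
    rintro (_ | ⟨i, _ | _⟩) g t ht
    · obtain ⟨i, hi⟩ := ht
      exact ⟨i, by rwa [orbitHull_eq hmono (smul_mem_orbitHull hmono g self_mem_orbitHull)]⟩
    · exact smul_mem_crossingBelow hmono g ht
    · exact smul_mem_crossingAbove hmono g ht
  have hDne : ∀ d, fixingSubgroup G (D d) ≠ ⊥ := by
    rintro (_ | ⟨i, _ | _⟩)
    · refine fun h => huv ((Subgroup.eq_bot_iff_forall _).1 h _ ?_)
      rw [mem_fixingSubgroup_iff]
      rintro t ⟨i, hi⟩
      have hl : ∀ g : G, Tendsto (fun t : K => g • t) (𝓟 (orbitHull G t)) (𝓟 (orbitHull G t)) :=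
        fun g => tendsto_principal_principal.2 fun s => smul_mem_orbitHull hmono g
      exact eventually_principal.1 (eventually_commutator_commutator_smul_of_mem hl
        (mem_principal.2 hi) (hu i) (hv i)) t self_mem_orbitHull
    · exact fixingSubgroup_ne_bot_of_subset_orbitHull hG1 hne
        fun t => crossingBelow_subset hmono (hJ i)
    · exact fixingSubgroup_ne_bot_of_subset_orbitHull hG1 hne
        fun t => crossingAbove_subset hmono (hJ i)
  have hDcov : ∀ t, ∃ d, t ∈ D d := by
    intro t
    obtain ⟨i, hi⟩ := hcov t
    by_cases hs : orbitHull G t ⊆ J i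
    · exact ⟨none, i, hs⟩
    obtain ⟨s, hs, hs'⟩ := Set.not_subset.1 hs
    rcases lt_trichotomy s t with h | rfl | h
    · exact ⟨some (i, false), t, self_mem_orbitHull, s, hs, hi, hs', h⟩
    · exact absurd hi hs'
    · exact ⟨some (i, true), t, self_mem_orbitHull, s, hs, hi, hs', h⟩
  obtain ⟨g, hg, hg1⟩ := (Subgroup.bot_or_exists_ne_one _).resolve_left
    (hG.iInf_ne_bot hG1 _ (fun d => fixingSubgroup_normal (hDinv d)) hDne)
  refine ⟨g, hg1, fun t => ?_⟩
  obtain ⟨d, hd⟩ := hDcov t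
  exact (mem_fixingSubgroup_iff G).1 (Subgroup.mem_iInf.1 hg d) t hd

section Ultraproduct

variable {X : Type*} {G : Type*} [Group G]

/-- A family of actions on `ℝ` induces an action on the hyperreals. -/
@[reducible]
def germMulAction (θ : X → G →* Equiv.Perm ℝ) (l : Filter X) : MulAction G (l.Germ ℝ) where
  smul g τ := Germ.map₂ (fun (F : Equiv.Perm ℝ) t => F t) (↑fun z => θ z g) τ
  one_smul τ := by
    induction τ using Germ.inductionOn with
    | h t => exact Germ.coe_eq.2 (.of_forall fun z => by simp)
  mul_smul g h τ := by
    induction τ using Germ.inductionOn with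
    | h t => exact Germ.coe_eq.2 (.of_forall fun z => by simp)

/-- If no nontrivial element acts trivially on all fibers, then there is an ultrafilter for which
every nontrivial element acts nontrivially on almost all fibers. -/
theorem exists_ultrafilter_forall_ne_one (hG : CommutingPowersMeet G) (hG1 : ∃ g : G, g ≠ 1)
    {P : Type*} [Group P] (θ : X → G →* P) (hθ : ∀ g, g ≠ 1 → ∃ z, θ z g ≠ 1) :
    ∃ U : Ultrafilter X, ∀ g, g ≠ 1 → ∀ᶠ z in U, θ z g ≠ 1 := by
  let S : {g : G // g ≠ 1} → Set X := fun g => {z | θ z g ≠ 1}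
  obtain ⟨U, hU⟩ := Ultrafilter.exists_ultrafilter_of_finite_inter_nonempty (Set.range S) (by
    intro T hT
    choose g hg using fun s : T => hT s.2
    have hne := hG.iInf_ne_bot hG1 (fun s : T => Subgroup.normalClosure {(g s : G)})
      (fun s => Subgroup.normalClosure_normal) (fun s h => (g s).2
        ((Subgroup.eq_bot_iff_forall _).1 h _ (Subgroup.subset_normalClosure rfl)))
    obtain ⟨w, hw, hw1⟩ := (Subgroup.bot_or_exists_ne_one _).resolve_left hne
    obtain ⟨z, hz⟩ := hθ w hw1
    refine ⟨z, fun s hs => ?_⟩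
    have hs' : S (g ⟨s, hs⟩) = s := hg ⟨s, hs⟩
    rw [← hs']
    intro h
    refine hz ?_
    have : Subgroup.normalClosure {(g ⟨s, hs⟩ : G)} ≤ (θ z).ker :=
      Subgroup.normalClosure_le_normal (by simpa [MonoidHom.mem_ker] using h)
    exact this (Subgroup.mem_iInf.1 hw ⟨s, hs⟩))
  exact ⟨U, fun g hg => hU ⟨⟨g, hg⟩, rfl⟩⟩

theorem exists_ne_one_forall_eq (θ : X → G →* Equiv.Perm ℝ)
    (hmono : ∀ z g, Monotone (θ z g)) (hG : CommutingPowersMeet G)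
    {u v : G} (huv : ⁅⁅u, v⁆, ⁅u, v⁻¹⁆⁆ ≠ 1) {ι : Type*} [Finite ι] {J : ι → X → Set ℝ}
    (hJ : ∀ i z, (J i z).OrdConnected) (hcov : ∀ z t, ∃ i, t ∈ J i z)
    (hu : ∀ i z, ∃ a b : ℝ, ∀ t ∈ J i z, θ z u t = a * t + b)
    (hv : ∀ i z, ∃ a b : ℝ, ∀ t ∈ J i z, θ z v t = a * t + b) :
    ∃ g : G, g ≠ 1 ∧ ∀ z, θ z g = 1 := by
  by_contra! hcon
  obtain ⟨U, hU⟩ := exists_ultrafilter_forall_ne_one hG ⟨_, huv⟩ θ hcon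
  let _ : MulAction G ((U : Filter X).Germ ℝ) := germMulAction θ U
  have hsmul : ∀ (g : G) (t : X → ℝ),
      g • (t : (U : Filter X).Germ ℝ) = ((fun z => θ z g (t z) : X → ℝ) : (U : Filter X).Germ ℝ) :=
    fun _ _ => rfl
  let J' : ι → Set ((U : Filter X).Germ ℝ) :=
    fun i => {τ | ∃ t : X → ℝ, τ = t ∧ ∀ᶠ z in U, t z ∈ J i z}
  have haff : ∀ w : G, (∀ i z, ∃ a b : ℝ, ∀ t ∈ J i z, θ z w t = a * t + b) →
      ∀ i, ∃ a b : (U : Filter X).Germ ℝ, ∀ τ ∈ J' i, w • τ = a * τ + b := by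
    intro w hw i
    choose a b hab using hw i
    refine ⟨a, b, ?_⟩
    rintro _ ⟨t, rfl, ht⟩
    rw [hsmul, ← Germ.coe_mul, ← Germ.coe_add, Germ.coe_eq]
    exact ht.mono fun z hz => hab z _ hz
  obtain ⟨g, hg, hg1⟩ := exists_ne_one_forall_smul_eq (G := G) (K := (U : Filter X).Germ ℝ)
    (J := J') (by
      intro g σ τ
      refine Germ.inductionOn₂ σ τ fun s t hst => ?_
      exact Germ.coe_le.2 ((Germ.coe_le.1 hst).mono fun z hz => hmono z g hz)) hG huv (by
      refine fun i => ⟨?_⟩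
      rintro _ ⟨s, rfl, hs⟩ _ ⟨t, rfl, ht⟩ σ
      induction σ using Germ.inductionOn with
      | h r =>
        rintro ⟨hsr, hrt⟩
        refine ⟨r, rfl, ?_⟩
        filter_upwards [hs, ht, Germ.coe_le.1 hsr, Germ.coe_le.1 hrt] with z h1 h2 h3 h4
        exact (hJ i z).out h1 h2 ⟨h3, h4⟩) (by
      intro τ
      induction τ using Germ.inductionOn with
      | h t =>
        by_contra! h
        have h' : ∀ᶠ z in (U : Filter X), ∀ i, t z ∉ J i z := eventually_all.2 fun i =>
          Ultrafilter.eventually_not.2 fun hi => h i ⟨t, rfl, hi⟩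
        obtain ⟨z, hz⟩ := h'.exists
        obtain ⟨i, hi⟩ := hcov z (t z)
        exact hz i hi) (haff u hu) (haff v hv)
  have hmove : ∀ z, ∃ t, θ z g ≠ 1 → θ z g t ≠ t := by
    intro z
    by_contra! h
    exact (h 0).1 (Equiv.ext fun t => (h t).2)
  choose t ht using hmove
  have hfix := hg1 t
  rw [hsmul, Germ.coe_eq] at hfix
  obtain ⟨z, hz, hz'⟩ := (hfix.and (hU g hg)).exists
  exact ht z hz' hz

end Ultraproduct

section Fibers

variable {n : ℕ}

/-- `f` preserves all coordinates except the coordinate `ℓ`. -/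
def PreservesOtherCoords (ℓ : Fin n) (f : Homeomorph (Cube n) (Cube n)) : Prop :=
  ∀ (z : Cube n) (i : Fin n), i ≠ ℓ → (f z : Fin n → ℝ) i = (z : Fin n → ℝ) i

theorem preservesOtherCoords_of_image_vertLine {ℓ : Fin n} (hℓ : (ℓ : ℕ) + 1 = n)
    {f : Homeomorph (Cube n) (Cube n)} (hf : ∀ c : Fin n → ℝ, ⇑f '' VertLine c = VertLine c) :
    PreservesOtherCoords ℓ f := by
  intro z i hi
  have h : f z ∈ VertLine (z : Fin n → ℝ) := hf z ▸ ⟨z, fun _ _ => rfl, rfl⟩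
  refine h i ?_
  have := Fin.val_ne_of_ne hi
  omega

/-- The point of the fiber through `z` in direction `ℓ` with last coordinate `t`. -/
noncomputable def fiberPoint (ℓ : Fin n) (z : Cube n) (t : ℝ) : Cube n :=
  ⟨Function.update (z : Fin n → ℝ) ℓ (Set.projIcc (0 : ℝ) 1 zero_le_one t), by
    have ht := (Set.projIcc (0 : ℝ) 1 zero_le_one t).2
    constructor <;> intro i <;> by_cases hi : i = ℓ
    · subst hi; simpa using ht.1
    · simpa [hi] using z.2.1 i
    · subst hi; simpa using ht.2
    · simpa [hi] using z.2.2 i⟩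

variable {ℓ : Fin n} {z : Cube n} {t : ℝ}

theorem coe_fiberPoint (ht : t ∈ Set.Icc (0 : ℝ) 1) :
    (fiberPoint ℓ z t : Fin n → ℝ) = Function.update (z : Fin n → ℝ) ℓ t := by
  simp [fiberPoint, Set.projIcc_of_mem zero_le_one ht]

theorem continuous_fiberPoint : Continuous (fiberPoint ℓ z) := by
  refine Continuous.subtype_mk (f := fun t : ℝ => Function.update (z : Fin n → ℝ) ℓ
    (Set.projIcc (0 : ℝ) 1 zero_le_one t : ℝ)) ?_ _
  exact continuous_const.update ℓ (continuous_subtype_val.comp continuous_projIcc)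

theorem apply_mem_Icc (z : Cube n) (ℓ : Fin n) : (z : Fin n → ℝ) ℓ ∈ Set.Icc (0 : ℝ) 1 :=
  ⟨z.2.1 ℓ, z.2.2 ℓ⟩

theorem fiberPoint_apply_self : fiberPoint ℓ z ((z : Fin n → ℝ) ℓ) = z :=
  Subtype.ext (by rw [coe_fiberPoint (apply_mem_Icc z ℓ), Function.update_eq_self])

theorem PreservesOtherCoords.apply_fiberPoint {f : Homeomorph (Cube n) (Cube n)}
    (hf : PreservesOtherCoords ℓ f) :
    f (fiberPoint ℓ z t) = fiberPoint ℓ z ((f (fiberPoint ℓ z t) : Fin n → ℝ) ℓ) := by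
  refine Subtype.ext (funext fun i => ?_)
  rw [coe_fiberPoint (apply_mem_Icc _ ℓ)]
  by_cases hi : i = ℓ
  · subst hi; simp
  · rw [hf _ i hi]
    simp [fiberPoint, hi]

open scoped Classical in
/-- The restriction of `f` to the fiber through `z`, extended by the identity. -/
noncomputable def fiberMap (ℓ : Fin n) (f : Homeomorph (Cube n) (Cube n)) (z : Cube n) (t : ℝ) :
    ℝ :=
  if t ∈ Set.Icc (0 : ℝ) 1 then (f (fiberPoint ℓ z t) : Fin n → ℝ) ℓ else t

theorem fiberMap_of_mem {f : Homeomorph (Cube n) (Cube n)} (ht : t ∈ Set.Icc (0 : ℝ) 1) :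
    fiberMap ℓ f z t = (f (fiberPoint ℓ z t) : Fin n → ℝ) ℓ := if_pos ht

theorem fiberMap_of_notMem {f : Homeomorph (Cube n) (Cube n)} (ht : t ∉ Set.Icc (0 : ℝ) 1) :
    fiberMap ℓ f z t = t := if_neg ht

theorem fiberMap_mem {f : Homeomorph (Cube n) (Cube n)} (ht : t ∈ Set.Icc (0 : ℝ) 1) :
    fiberMap ℓ f z t ∈ Set.Icc (0 : ℝ) 1 := by
  rw [fiberMap_of_mem ht]
  exact apply_mem_Icc _ ℓ

theorem fiberMap_one : fiberMap ℓ 1 z t = t := by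
  by_cases ht : t ∈ Set.Icc (0 : ℝ) 1
  · rw [fiberMap_of_mem ht]
    change (fiberPoint ℓ z t : Fin n → ℝ) ℓ = t
    rw [coe_fiberPoint ht, Function.update_self]
  · exact fiberMap_of_notMem ht

theorem fiberMap_mul {f g : Homeomorph (Cube n) (Cube n)} (hg : PreservesOtherCoords ℓ g) :
    fiberMap ℓ (f * g) z t = fiberMap ℓ f z (fiberMap ℓ g z t) := by
  by_cases ht : t ∈ Set.Icc (0 : ℝ) 1
  · rw [fiberMap_of_mem (fiberMap_mem ht), fiberMap_of_mem ht, fiberMap_of_mem ht,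
      ← hg.apply_fiberPoint]
    rfl
  · rw [fiberMap_of_notMem ht, fiberMap_of_notMem ht, fiberMap_of_notMem ht]

theorem eq_one_of_forall_fiberMap_eq {f : Homeomorph (Cube n) (Cube n)}
    (hf : PreservesOtherCoords ℓ f) (h : ∀ z t, fiberMap ℓ f z t = t) : f = 1 := by
  refine Homeomorph.ext fun z => ?_
  change f z = z
  have h1 := h z ((z : Fin n → ℝ) ℓ)
  rw [fiberMap_of_mem (apply_mem_Icc z ℓ), fiberPoint_apply_self] at h1
  have h2 := hf.apply_fiberPoint (z := z) (t := (z : Fin n → ℝ) ℓ)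
  rwa [fiberPoint_apply_self, h1, fiberPoint_apply_self] at h2

theorem monotone_of_monotoneOn_Icc {g : ℝ → ℝ} (hg : MonotoneOn g (Set.Icc 0 1))
    (hmem : ∀ t ∈ Set.Icc (0 : ℝ) 1, g t ∈ Set.Icc (0 : ℝ) 1)
    (hid : ∀ t ∉ Set.Icc (0 : ℝ) 1, g t = t) : Monotone g := by
  intro x y hxy
  by_cases hx : x ∈ Set.Icc (0 : ℝ) 1 <;> by_cases hy : y ∈ Set.Icc (0 : ℝ) 1
  · exact hg hx hy hxy
  · rw [hid y hy]
    have : 1 < y := by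
      by_contra! h
      exact hy ⟨hx.1.trans hxy, h⟩
    exact (hmem x hx).2.trans this.le
  · rw [hid x hx]
    have : x < 0 := by
      by_contra! h
      exact hx ⟨h, hxy.trans hy.2⟩
    exact this.le.trans (hmem y hy).1
  · rwa [hid x hx, hid y hy]

theorem monotone_fiberMap_mul_self {f : Homeomorph (Cube n) (Cube n)}
    (hf : PreservesOtherCoords ℓ f) : Monotone (fiberMap ℓ (f * f) z) := by
  refine monotone_of_monotoneOn_Icc ?_ (fun t => fiberMap_mem) (fun t => fiberMap_of_notMem)
  let g : ℝ → ℝ := fun t => (f (fiberPoint ℓ z t) : Fin n → ℝ) ℓ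
  have hgc : Continuous g := (continuous_apply ℓ).comp
    (continuous_subtype_val.comp (f.continuous.comp continuous_fiberPoint))
  have hgi : Set.InjOn g (Set.Icc 0 1) := by
    intro x hx y hy hxy
    have h : f (fiberPoint ℓ z x) = f (fiberPoint ℓ z y) := by
      rw [hf.apply_fiberPoint (t := x), hf.apply_fiberPoint (t := y)]
      exact congrArg (fiberPoint ℓ z) hxy
    have h2 := congrFun (congrArg Subtype.val (f.injective h)) ℓ
    rwa [coe_fiberPoint hx, coe_fiberPoint hy, Function.update_self, Function.update_self] at h2
  have hgm : ∀ t, g t ∈ Set.Icc (0 : ℝ) 1 := fun t => apply_mem_Icc _ ℓ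
  have hfg : ∀ t ∈ Set.Icc (0 : ℝ) 1, fiberMap ℓ (f * f) z t = g (g t) := by
    intro t ht
    rw [fiberMap_mul hf, fiberMap_of_mem (fiberMap_mem ht), fiberMap_of_mem ht]
  intro x hx y hy hxy
  rw [hfg x hx, hfg y hy]
  rcases hgc.continuousOn.strictMonoOn_of_injOn_Icc' zero_le_one hgi with h | h
  · exact h.monotoneOn (hgm x) (hgm y) (h.monotoneOn hx hy hxy)
  · exact h.antitoneOn (hgm y) (hgm x) (h.antitoneOn hx hy hxy)

theorem update_eq_lineMap {ι : Type*} [DecidableEq ι] (x : ι → ℝ) (i : ι) (t : ℝ) :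
    Function.update x i t =
      AffineMap.lineMap (Function.update x i 0) (Function.update x i 1) t := by
  ext j
  rw [AffineMap.lineMap_apply]
  by_cases h : j = i
  · subst h; simp
  · simp [h]

/-- The fibers of a piecewise linear map are piecewise affine, with a uniformly bounded number of
pieces. -/
theorem IsPLCubeHomeo.exists_fiber_pieces {f : Homeomorph (Cube n) (Cube n)} (hf : IsPLCubeHomeo f)
    (ℓ : Fin n) :
    ∃ (ι : Type) (_ : Finite ι) (J : ι → Cube n → Set ℝ), (∀ i z, (J i z).OrdConnected) ∧
      (∀ z t, ∃ i, t ∈ J i z) ∧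
      ∀ i z, ∃ a b : ℝ, ∀ t ∈ J i z, fiberMap ℓ f z t = a * t + b := by
  obtain ⟨k, p, A, -, -, hcov, -, hA⟩ := hf
  refine ⟨Option (Option (Fin k)), inferInstance, fun i z => match i with
    | none => Set.Iio 0
    | some none => Set.Ioi 1
    | some (some i) => Set.Icc 0 1 ∩ (AffineMap.lineMap (k := ℝ)
        (Function.update (z : Fin n → ℝ) ℓ 0)
        (Function.update (z : Fin n → ℝ) ℓ 1)) ⁻¹' convexHull ℝ (Set.range (p i)), ?_, ?_, ?_⟩
  · rintro (_ | _ | i) z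
    · exact Set.ordConnected_Iio
    · exact Set.ordConnected_Ioi
    · exact Set.ordConnected_Icc.inter ((convex_convexHull ℝ _).affine_preimage _).ordConnected
  · intro z t
    rcases lt_or_ge t 0 with h0 | h0
    · exact ⟨none, h0⟩
    rcases lt_or_ge 1 t with h1 | h1
    · exact ⟨some none, h1⟩
    have hz : (fiberPoint ℓ z t : Fin n → ℝ) ∈ ⋃ i, convexHull ℝ (Set.range (p i)) :=
      hcov.symm.subset (fiberPoint ℓ z t).2
    rw [coe_fiberPoint ⟨h0, h1⟩, update_eq_lineMap] at hz
    obtain ⟨i, hi⟩ := Set.mem_iUnion.1 hz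
    exact ⟨some (some i), ⟨h0, h1⟩, hi⟩
  · rintro (_ | _ | i) z
    · exact ⟨1, 0, fun t ht => by
        rw [fiberMap_of_notMem fun h => absurd h.1 (not_le.2 ht)]; ring⟩
    · exact ⟨1, 0, fun t ht => by
        rw [fiberMap_of_notMem fun h => absurd h.2 (not_le.2 ht)]; ring⟩
    · refine ⟨A i (Function.update (z : Fin n → ℝ) ℓ 1) ℓ -
        A i (Function.update (z : Fin n → ℝ) ℓ 0) ℓ,
        A i (Function.update (z : Fin n → ℝ) ℓ 0) ℓ, ?_⟩
      rintro t ⟨ht, hti⟩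
      rw [fiberMap_of_mem ht, hA i _ (by rwa [coe_fiberPoint ht, update_eq_lineMap]),
        coe_fiberPoint ht, update_eq_lineMap, AffineMap.apply_lineMap, AffineMap.lineMap_apply]
      simp only [vsub_eq_sub, vadd_eq_add, Pi.add_apply, Pi.smul_apply, Pi.sub_apply, smul_eq_mul]
      ring

/-- The action on the fiber through `z`. -/
noncomputable def fiberAction {G : Type*} [Group G] (φ : G →* Homeomorph (Cube n) (Cube n))
    (hφ : ∀ g, PreservesOtherCoords ℓ (φ g)) (z : Cube n) : G →* Equiv.Perm ℝ :=
  MonoidHom.toHomPerm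
    { toFun := fun g => (fiberMap ℓ (φ g) z : ℝ → ℝ)
      map_one' := funext fun t => by rw [map_one]; exact fiberMap_one
      map_mul' := fun g h => funext fun t => by rw [map_mul]; exact fiberMap_mul (hφ h) }

theorem fiberAction_apply {G : Type*} [Group G] (φ : G →* Homeomorph (Cube n) (Cube n))
    (hφ : ∀ g, PreservesOtherCoords ℓ (φ g)) (z : Cube n) (g : G) (t : ℝ) :
    fiberAction φ hφ z g t = fiberMap ℓ (φ g) z t := rfl

end Fibers

/-- The elements acting monotonically on a family of linear orders. -/
def monotoneSubgroup {X G α : Type*} [Group G] [LinearOrder α] (θ : X → G →* Equiv.Perm α) :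
    Subgroup G where
  carrier := {g | ∀ z, Monotone (θ z g)}
  one_mem' z := by
    rw [map_one]
    exact monotone_id
  mul_mem' hg hh z := by
    rw [map_mul]
    exact (hg z).comp (hh z)
  inv_mem' {g} hg z x y hxy := by
    by_contra! h
    have h2 := hg z h.le
    rw [map_inv, Equiv.Perm.inv_def, Equiv.apply_symm_apply, Equiv.apply_symm_apply] at h2
    rw [hxy.antisymm h2] at h
    exact h.false

theorem FreeGroup.commutator_commutator_sq_ne_one :
    ⁅⁅FreeGroup.of (0 : Fin 2) * FreeGroup.of 0, FreeGroup.of (1 : Fin 2) * FreeGroup.of 1⁆,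
      ⁅FreeGroup.of (0 : Fin 2) * FreeGroup.of 0,
        (FreeGroup.of (1 : Fin 2) * FreeGroup.of 1)⁻¹⁆⁆ ≠ 1 := by
  decide

/-- For every `n ≥ 1`, the group `PL(Iⁿ, F)` of orientation-preserving piecewise linear
homeomorphisms of the cube preserving each vertical line contains no subgroup isomorphic
to the free group of rank 2. -/
theorem plCubeVert_no_free_subgroup (n : ℕ) (hn : 1 ≤ n) :
    ¬ ∃ φ : FreeGroup (Fin 2) →* Homeomorph (Cube n) (Cube n),
        Function.Injective φ ∧
          ∀ w, IsPLCubeHomeo (φ w) ∧ ∀ c : Fin n → ℝ, ⇑(φ w) '' VertLine c = VertLine c := by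
  rintro ⟨φ, hinj, hφ⟩
  let ℓ : Fin n := ⟨n - 1, by omega⟩
  have hℓ : (ℓ : ℕ) + 1 = n := by simp only [ℓ]; omega
  have hpres : ∀ w, PreservesOtherCoords ℓ (φ w) :=
    fun w => preservesOtherCoords_of_image_vertLine hℓ (hφ w).2
  let H := monotoneSubgroup (fiberAction φ hpres)
  have hsq : ∀ i : Fin 2, FreeGroup.of i * FreeGroup.of i ∈ H := by
    intro i z x y hxy
    rw [fiberAction_apply, fiberAction_apply, map_mul]
    exact monotone_fiberMap_mul_self (hpres _) hxy
  let u : H := ⟨_, hsq 0⟩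
  let v : H := ⟨_, hsq 1⟩
  have huv : ⁅⁅u, v⁆, ⁅u, v⁻¹⁆⁆ ≠ 1 := fun h =>
    FreeGroup.commutator_commutator_sq_ne_one (congrArg Subtype.val h)
  obtain ⟨ι, _, J, hJ, hJcov, hJu⟩ := (hφ u).1.exists_fiber_pieces ℓ
  obtain ⟨κ, _, L, hL, hLcov, hLv⟩ := (hφ v).1.exists_fiber_pieces ℓ
  obtain ⟨g, hg, hg1⟩ := exists_ne_one_forall_eq (G := H)
    (fun z => (fiberAction φ hpres z).comp H.subtype) (fun z g => g.2 z)
    ((FreeGroup.commutingPowersMeet (Fin 2)).of_injective H.subtype H.subtype_injective) huv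
    (J := fun (i : ι × κ) z => J i.1 z ∩ L i.2 z) (fun i z => (hJ i.1 z).inter (hL i.2 z))
    (fun z t => by
      obtain ⟨i, hi⟩ := hJcov z t
      obtain ⟨j, hj⟩ := hLcov z t
      exact ⟨(i, j), hi, hj⟩)
    (fun i z => (hJu i.1 z).imp fun a => Exists.imp fun b h t ht => h t ht.1)
    (fun i z => (hLv i.2 z).imp fun a => Exists.imp fun b h t ht => h t ht.2)
  refine hg (Subtype.ext (hinj ?_))
  rw [OneMemClass.coe_one, map_one]
  exact eq_one_of_forall_fiberMap_eq (hpres g) fun z t => Equiv.congr_fun (hg1 z) t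
end

section
/- For every n ≥ 2, the group PL(Iⁿ) contains a subgroup isomorphic to the free group of rank 2. -/
section PiecewiseLinear

open Set

section Simplices

variable {ι E : Type*} [Fintype ι] [AddCommGroup E] [Module ℝ E]

lemma mem_convexHull_range_iff (p : ι → E) (x : E) :
    x ∈ convexHull ℝ (range p) ↔
      ∃ w : ι → ℝ, (∀ i, 0 ≤ w i) ∧ ∑ i, w i = 1 ∧ ∑ i, w i • p i = x := by
  classical
  constructor
  · rw [convexHull_range_eq_exists_affineCombination]
    rintro ⟨s, w, h0, h1, rfl⟩
    refine ⟨fun i => if i ∈ s then w i else 0, fun i => ?_, by simpa using h1, ?_⟩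
    · dsimp only
      split_ifs with h
      exacts [h0 i h, le_rfl]
    · rw [s.affineCombination_eq_linear_combination _ _ h1]
      simp [ite_smul]
  · rintro ⟨w, h0, h1, rfl⟩
    exact mem_convexHull_of_exists_fintype w p h0 h1 (fun i => mem_range_self i) rfl

lemma affineIndependent_iff_forall_eq_zero (p : ι → E) :
    AffineIndependent ℝ p ↔
      ∀ w : ι → ℝ, ∑ i, w i = 0 → ∑ i, w i • p i = 0 → w = 0 := by
  rw [affineIndependent_iff_of_fintype]
  refine forall₂_congr fun w hw => ?_
  rw [Finset.univ.weightedVSub_eq_linear_combination hw, funext_iff]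
  rfl

lemma AffineIndependent.weights_eq {p : ι → E} (hp : AffineIndependent ℝ p) {w v : ι → ℝ}
    (h1 : ∑ i, w i = ∑ i, v i) (h2 : ∑ i, w i • p i = ∑ i, v i • p i) : w = v := by
  have := (affineIndependent_iff_forall_eq_zero p).1 hp (w - v)
    (by simp [Finset.sum_sub_distrib, h1]) (by simp [sub_smul, Finset.sum_sub_distrib, h2])
  exact sub_eq_zero.1 this

end Simplices

section SlideVertex

variable {ι E : Type*} [DecidableEq ι] [AddCommGroup E] [Module ℝ E]

/-- Replace the vertex `p a` by the point at parameter `t` on the edge from `p a` to `p b`. -/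
def slideVertex (p : ι → E) (a b : ι) (t : ℝ) : ι → E :=
  Function.update p a (p a + t • (p b - p a))

/-- The weights with respect to `p` of a combination of the points `slideVertex p a b t`. -/
def slideWeights (a b : ι) (t : ℝ) (w : ι → ℝ) : ι → ℝ :=
  fun i => w i + w a * t * ((if i = b then 1 else 0) - if i = a then 1 else 0)

lemma slideWeights_self {a b : ι} (hab : a ≠ b) (t : ℝ) (w : ι → ℝ) :
    slideWeights a b t w a = (1 - t) * w a := by
  simp [slideWeights, hab]; ring

lemma slideWeights_target {a b : ι} (hab : a ≠ b) (t : ℝ) (w : ι → ℝ) :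
    slideWeights a b t w b = w b + t * w a := by
  simp [slideWeights, hab.symm]; ring

lemma slideWeights_of_ne {a b i : ι} (ha : i ≠ a) (hb : i ≠ b) (t : ℝ) (w : ι → ℝ) :
    slideWeights a b t w i = w i := by
  simp [slideWeights, ha, hb]

lemma convexHull_slideVertex_subset (p : ι → E) (a b : ι) {t : ℝ} (h0 : 0 ≤ t) (h1 : t ≤ 1) :
    convexHull ℝ (range (slideVertex p a b t)) ⊆ convexHull ℝ (range p) := by
  refine convexHull_min ?_ (convex_convexHull ℝ _)
  rintro _ ⟨i, rfl⟩
  by_cases hi : i = a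
  · subst hi
    simp only [slideVertex, Function.update_self]
    exact (convex_convexHull ℝ _).add_smul_sub_mem (subset_convexHull ℝ _ (mem_range_self i))
      (subset_convexHull ℝ _ (mem_range_self b)) ⟨h0, h1⟩
  · simp only [slideVertex, Function.update_of_ne hi]
    exact subset_convexHull ℝ _ (mem_range_self i)

variable [Fintype ι]

lemma sum_slideWeights (a b : ι) (t : ℝ) (w : ι → ℝ) :
    ∑ i, slideWeights a b t w i = ∑ i, w i := by
  simp [slideWeights, Finset.sum_add_distrib, ← Finset.mul_sum, Finset.sum_sub_distrib]

lemma sum_slideWeights_smul (p : ι → E) (a b : ι) (t : ℝ) (w : ι → ℝ) :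
    ∑ i, slideWeights a b t w i • p i = ∑ i, w i • slideVertex p a b t i := by
  have h : ∀ i, slideVertex p a b t i = p i + (if i = a then t • (p b - p a) else 0) := by
    intro i
    by_cases hi : i = a
    · subst hi; simp [slideVertex]
    · simp [slideVertex, hi]
  simp only [h, slideWeights, add_smul, smul_add, Finset.sum_add_distrib, mul_smul, sub_smul,
    ← Finset.smul_sum, Finset.sum_sub_distrib, ite_smul, one_smul, zero_smul, smul_ite, smul_zero,
    Finset.sum_ite_eq', Finset.mem_univ, if_true]

lemma AffineIndependent.slideVertex {p : ι → E} (hp : AffineIndependent ℝ p) {a b : ι}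
    (hab : a ≠ b) {t : ℝ} (ht : t < 1) : AffineIndependent ℝ (slideVertex p a b t) := by
  rw [affineIndependent_iff_forall_eq_zero] at hp ⊢
  intro w h1 h2
  have h := hp (slideWeights a b t w) (by rw [sum_slideWeights, h1])
    (by rw [sum_slideWeights_smul, h2])
  have ha : w a = 0 := by
    have := congrFun h a
    rw [slideWeights_self hab] at this
    simpa [(sub_pos.2 ht).ne'] using this
  funext i
  have := congrFun h i
  simpa [slideWeights, ha] using this

lemma mem_convexHull_slideVertex (p : ι → E) {a b : ι} (hab : a ≠ b) {t : ℝ} (h1 : t < 1)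
    {w : ι → ℝ} (hw : ∀ i, 0 ≤ w i) (hs : ∑ i, w i = 1) (h : t * w a ≤ (1 - t) * w b) :
    ∑ i, w i • p i ∈ convexHull ℝ (range (slideVertex p a b t)) := by
  rw [mem_convexHull_range_iff]
  have ht : 0 < 1 - t := sub_pos.2 h1
  obtain ⟨v, hv⟩ : ∃ v : ι → ℝ, slideWeights a b t v = w ∧ ∀ i, 0 ≤ v i := by
    refine ⟨fun i => if i = a then w a / (1 - t) else
      if i = b then w b - t * (w a / (1 - t)) else w i, ?_, ?_⟩
    · funext i
      by_cases ha : i = a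
      · subst ha
        rw [slideWeights_self hab]
        simp [mul_div_cancel₀ _ ht.ne']
      · by_cases hb : i = b
        · subst hb
          rw [slideWeights_target hab]
          simp [ha]
        · rw [slideWeights_of_ne ha hb]
          simp [ha, hb]
    · intro i
      dsimp only
      split_ifs
      · exact div_nonneg (hw a) ht.le
      · rw [sub_nonneg, ← mul_div_assoc, div_le_iff₀ ht]
        linarith
      · exact hw i
  refine ⟨v, hv.2, ?_, ?_⟩
  · rw [← sum_slideWeights a b t, hv.1, hs]
  · rw [← sum_slideWeights_smul, hv.1]

lemma convexHull_subset_union_slideVertex (p : ι → E) {a b : ι} (hab : a ≠ b) {t : ℝ}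
    (h0 : 0 < t) (h1 : t < 1) :
    convexHull ℝ (range p) ⊆ convexHull ℝ (range (slideVertex p a b t)) ∪
      convexHull ℝ (range (slideVertex p b a (1 - t))) := by
  intro x hx
  obtain ⟨w, hw, hs, rfl⟩ := (mem_convexHull_range_iff p x).1 hx
  rcases le_total (t * w a) ((1 - t) * w b) with h | h
  · exact Or.inl (mem_convexHull_slideVertex p hab h1 hw hs h)
  · exact Or.inr (mem_convexHull_slideVertex p hab.symm (by linarith) hw hs (by linarith))

end SlideVertex

section Subdivisions

variable {n : ℕ}

lemma AffineIndependent.exists_pos_weights {p : Fin (n + 1) → Fin n → ℝ}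
    (hp : AffineIndependent ℝ p) {x : Fin n → ℝ} (hx : x ∈ interior (convexHull ℝ (range p))) :
    ∃ w : Fin (n + 1) → ℝ, (∀ i, 0 < w i) ∧ ∑ i, w i = 1 ∧ ∑ i, w i • p i = x := by
  have htop : affineSpan ℝ (range p) = ⊤ := by
    rw [hp.affineSpan_eq_top_iff_card_eq_finrank_add_one]
    simp
  let B : AffineBasis (Fin (n + 1)) ℝ (Fin n → ℝ) := ⟨p, hp, htop⟩
  have hB : x ∈ interior (convexHull ℝ (range B)) := hx
  rw [B.interior_convexHull] at hB
  exact ⟨fun i => B.coord i x, hB, B.sum_coord_apply_eq_one x,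
    B.linear_combination_coord_eq_self x⟩

lemma disjoint_interior_slideVertex {p : Fin (n + 1) → Fin n → ℝ}
    (hp : AffineIndependent ℝ p) {a b : Fin (n + 1)} (hab : a ≠ b) {t : ℝ}
    (h0 : 0 < t) (h1 : t < 1) :
    Disjoint (interior (convexHull ℝ (range (slideVertex p a b t))))
      (interior (convexHull ℝ (range (slideVertex p b a (1 - t))))) := by
  rw [Set.disjoint_left]
  intro x hx hy
  obtain ⟨w, hw, hws, hwx⟩ := (hp.slideVertex hab h1).exists_pos_weights hx
  obtain ⟨v, hv, hvs, hvx⟩ :=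
    (hp.slideVertex hab.symm (show 1 - t < 1 by linarith)).exists_pos_weights hy
  have h := hp.weights_eq (w := slideWeights a b t w) (v := slideWeights b a (1 - t) v)
    (by rw [sum_slideWeights, sum_slideWeights, hws, hvs])
    (by rw [sum_slideWeights_smul, sum_slideWeights_smul, hwx, hvx])
  have ha := congrFun h a
  have hb := congrFun h b
  rw [slideWeights_self hab, slideWeights_target hab.symm] at ha
  rw [slideWeights_target hab, slideWeights_self hab.symm] at hb
  nlinarith [mul_pos (sub_pos.2 h1) (hw b), mul_pos h0 (hv a)]

/-- The simplex with vertices `p` is a finite union of nondegenerate simplices with pairwise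
disjoint interiors, each of which satisfies `R`. -/
def HasSubdivision (R : Set (Fin n → ℝ) → Prop) (p : Fin (n + 1) → Fin n → ℝ) : Prop :=
  ∃ (κ : Type) (_ : Fintype κ) (q : κ → Fin (n + 1) → Fin n → ℝ),
    (∀ i, AffineIndependent ℝ (q i)) ∧
    (∀ i j, i ≠ j → Disjoint (interior (convexHull ℝ (range (q i))))
      (interior (convexHull ℝ (range (q j))))) ∧
    (⋃ i, convexHull ℝ (range (q i))) = convexHull ℝ (range p) ∧
    ∀ i, R (convexHull ℝ (range (q i)))

variable {R : Set (Fin n → ℝ) → Prop}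

lemma HasSubdivision.self {p : Fin (n + 1) → Fin n → ℝ} (hp : AffineIndependent ℝ p)
    (hR : R (convexHull ℝ (range p))) : HasSubdivision R p :=
  ⟨Unit, inferInstance, fun _ => p, fun _ => hp, fun _ _ h => (h rfl).elim, iUnion_const _,
    fun _ => hR⟩

lemma HasSubdivision.of_slideVertex {p : Fin (n + 1) → Fin n → ℝ}
    (hp : AffineIndependent ℝ p) {a b : Fin (n + 1)} (hab : a ≠ b) {t : ℝ}
    (h0 : 0 < t) (h1 : t < 1) (hl : HasSubdivision R (slideVertex p a b t))
    (hr : HasSubdivision R (slideVertex p b a (1 - t))) : HasSubdivision R p := by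
  obtain ⟨κ, _, q, hq, hqd, hqu, hqR⟩ := hl
  obtain ⟨κ', _, q', hq', hqd', hqu', hqR'⟩ := hr
  have key : ∀ i j, Disjoint (interior (convexHull ℝ (range (q i))))
      (interior (convexHull ℝ (range (q' j)))) := fun i j =>
    (disjoint_interior_slideVertex hp hab h0 h1).mono
      (interior_mono (hqu ▸ subset_iUnion (fun i => convexHull ℝ (range (q i))) i))
      (interior_mono (hqu' ▸ subset_iUnion (fun i => convexHull ℝ (range (q' i))) j))
  refine ⟨κ ⊕ κ', inferInstance, Sum.elim q q', ?_, ?_, ?_, ?_⟩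
  · rintro (i | i)
    exacts [hq i, hq' i]
  · rintro (i | i) (j | j) hij
    · exact hqd i j fun h => hij (h ▸ rfl)
    · exact key i j
    · exact (key j i).symm
    · exact hqd' i j fun h => hij (h ▸ rfl)
  · rw [iUnion_sum]
    simp only [Sum.elim_inl, Sum.elim_inr, hqu, hqu']
    exact Subset.antisymm (union_subset (convexHull_slideVertex_subset p a b h0.le h1.le)
      (convexHull_slideVertex_subset p b a (by linarith) (by linarith)))
      (convexHull_subset_union_slideVertex p hab h0 h1)
  · rintro (i | i)
    exacts [hqR i, hqR' i]

lemma affineMap_slideVertex_self {p : Fin (n + 1) → Fin n → ℝ} (ℓ : (Fin n → ℝ) →ᵃ[ℝ] ℝ)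
    (a b : Fin (n + 1)) (t : ℝ) :
    ℓ (slideVertex p a b t a) = ℓ (p a) + t * (ℓ (p b) - ℓ (p a)) := by
  have : p a + t • (p b - p a) = AffineMap.lineMap (p a) (p b) t := by
    simp [AffineMap.lineMap_apply, add_comm]
  rw [slideVertex, Function.update_self, this, AffineMap.apply_lineMap, AffineMap.lineMap_apply]
  simp [add_comm]

/-- Cutting a simplex along a hyperplane: it suffices to subdivide the simplices lying on one
side. -/
lemma HasSubdivision.of_cut (ℓ : (Fin n → ℝ) →ᵃ[ℝ] ℝ) {p : Fin (n + 1) → Fin n → ℝ}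
    (hp : AffineIndependent ℝ p)
    (h : ∀ q : Fin (n + 1) → Fin n → ℝ, AffineIndependent ℝ q →
      convexHull ℝ (range q) ⊆ convexHull ℝ (range p) →
      (convexHull ℝ (range q) ⊆ {x | 0 ≤ ℓ x} ∨ convexHull ℝ (range q) ⊆ {x | ℓ x ≤ 0}) →
      HasSubdivision R q) : HasSubdivision R p := by
  induction hm : (Finset.univ.filter fun i => ℓ (p i) ≠ 0).card using Nat.strong_induction_on
    generalizing p with
  | _ m ih =>
  by_cases hpos : ∀ i, 0 ≤ ℓ (p i)
  · refine h p hp Subset.rfl (Or.inl (convexHull_min ?_ ?_))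
    · rintro _ ⟨i, rfl⟩
      exact hpos i
    · exact (convex_Ici (0 : ℝ)).affine_preimage ℓ
  by_cases hneg : ∀ i, ℓ (p i) ≤ 0
  · refine h p hp Subset.rfl (Or.inr (convexHull_min ?_ ?_))
    · rintro _ ⟨i, rfl⟩
      exact hneg i
    · exact (convex_Iic (0 : ℝ)).affine_preimage ℓ
  push Not at hpos hneg
  obtain ⟨a, ha⟩ := hpos
  obtain ⟨b, hb⟩ := hneg
  have hab : a ≠ b := by rintro rfl; linarith
  have hd : 0 < ℓ (p b) - ℓ (p a) := by linarith
  set t := -ℓ (p a) / (ℓ (p b) - ℓ (p a)) with ht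
  have h0 : 0 < t := div_pos (by linarith) hd
  have h1 : t < 1 := by rw [ht, div_lt_one hd]; linarith
  have htd : t * (ℓ (p b) - ℓ (p a)) = -ℓ (p a) := div_mul_cancel₀ _ hd.ne'
  have step : ∀ (c d : Fin (n + 1)) (s : ℝ), c ≠ d → 0 < s → s < 1 → ℓ (p c) ≠ 0 →
      ℓ (p c) + s * (ℓ (p d) - ℓ (p c)) = 0 → HasSubdivision R (slideVertex p c d s) := by
    intro c d s hcd hs0 hs1 hc hs
    have hzero : ℓ (slideVertex p c d s c) = 0 := by rw [affineMap_slideVertex_self, hs]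
    refine ih _ ?_ (hp.slideVertex hcd hs1) (fun q hq hqs => h q hq
      (hqs.trans (convexHull_slideVertex_subset p c d hs0.le hs1.le))) rfl
    rw [← hm]
    refine Finset.card_lt_card (Finset.ssubset_iff_of_subset ?_ |>.2 ⟨c, by simpa using hc, ?_⟩)
    · intro i
      by_cases hi : i = c
      · subst hi
        simp [hzero]
      · rw [Finset.mem_filter, Finset.mem_filter, slideVertex, Function.update_of_ne hi]
        exact id
    · simp [hzero]
  exact .of_slideVertex hp hab h0 h1 (step a b t hab h0 h1 ha.ne (by linarith))
    (step b a (1 - t) hab.symm (by linarith) (by linarith) hb.ne' (by linarith))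

end Subdivisions

section Cuts

variable {E : Type*} [AddCommGroup E] [Module ℝ E]

/-- `S` can be cut along finitely many hyperplanes into pieces that satisfy `R`. -/
inductive Cuttable (R : Set E → Prop) : Set E → Prop
  | of_holds {S : Set E} (h : R S) : Cuttable R S
  | cut {S : Set E} (ℓ : E →ᵃ[ℝ] ℝ) (hpos : Cuttable R (S ∩ {x | 0 ≤ ℓ x}))
      (hneg : Cuttable R (S ∩ {x | ℓ x ≤ 0})) : Cuttable R S

lemma Cuttable.bind {R R' : Set E → Prop} {S : Set E} (h : Cuttable R S)
    (hR : ∀ T ⊆ S, R T → Cuttable R' T) : Cuttable R' S := by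
  induction h with
  | of_holds h => exact hR _ Subset.rfl h
  | cut ℓ _ _ ih₁ ih₂ =>
    exact .cut ℓ (ih₁ fun T hT => hR T (hT.trans inter_subset_left))
      (ih₂ fun T hT => hR T (hT.trans inter_subset_left))

lemma Cuttable.preimage {F : Type*} [AddCommGroup F] [Module ℝ F] {R : Set E → Prop} {S : Set E}
    (h : Cuttable R S) (A : F →ᵃ[ℝ] E) : Cuttable (fun T => ∃ T', T ⊆ A ⁻¹' T' ∧ R T') (A ⁻¹' S) := by
  induction h with
  | of_holds h => exact .of_holds ⟨_, Subset.rfl, h⟩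
  | cut ℓ _ _ ih₁ ih₂ => exact .cut (ℓ.comp A) ih₁ ih₂

lemma Cuttable.mono {R : Set E → Prop} (hR : Antitone R) {S T : Set E} (h : Cuttable R S)
    (hT : T ⊆ S) : Cuttable R T := by
  induction h generalizing T with
  | of_holds h => exact .of_holds (hR hT h)
  | cut ℓ _ _ ih₁ ih₂ =>
    exact .cut ℓ (ih₁ (inter_subset_inter_left _ hT)) (ih₂ (inter_subset_inter_left _ hT))

lemma Cuttable.hasSubdivision {n : ℕ} {R : Set (Fin n → ℝ) → Prop} (hR : Antitone R)
    {S : Set (Fin n → ℝ)} (h : Cuttable R S) {p : Fin (n + 1) → Fin n → ℝ}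
    (hp : AffineIndependent ℝ p) (hpS : convexHull ℝ (range p) ⊆ S) : HasSubdivision R p := by
  induction h generalizing p with
  | of_holds h => exact .self hp (hR hpS h)
  | cut ℓ _ _ ih₁ ih₂ =>
    refine .of_cut ℓ hp fun q hq hqp hs => ?_
    rcases hs with hs | hs
    · exact ih₁ hq (subset_inter (hqp.trans hpS) hs)
    · exact ih₂ hq (subset_inter (hqp.trans hpS) hs)

/-- After finitely many cuts of `S`, the map `f` is given on each piece by an affine map
satisfying `Q`. -/
def PiecewiseAffineOn {F : Type*} [AddCommGroup F] [Module ℝ F] (Q : (E →ᵃ[ℝ] F) → Prop)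
    (f : E → F) (S : Set E) : Prop :=
  Cuttable (fun T => ∃ A, Q A ∧ EqOn f A T) S

lemma antitone_exists_eqOn {F : Type*} [AddCommGroup F] [Module ℝ F] (Q : (E →ᵃ[ℝ] F) → Prop)
    (f : E → F) : Antitone fun T : Set E => ∃ A, Q A ∧ EqOn f A T :=
  fun _ _ hST ⟨A, hA, h⟩ => ⟨A, hA, h.mono hST⟩

namespace PiecewiseAffineOn

variable {F G : Type*} [AddCommGroup F] [Module ℝ F] [AddCommGroup G] [Module ℝ G]

lemma of_affineMap {Q : (E →ᵃ[ℝ] F) → Prop} {A : E →ᵃ[ℝ] F} (hA : Q A) (S : Set E) :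
    PiecewiseAffineOn Q A S :=
  .of_holds ⟨A, hA, fun _ _ => rfl⟩

lemma mono {Q : (E →ᵃ[ℝ] F) → Prop} {f : E → F} {S T : Set E} (h : PiecewiseAffineOn Q f S)
    (hT : T ⊆ S) : PiecewiseAffineOn Q f T :=
  Cuttable.mono (antitone_exists_eqOn Q f) h hT

lemma comp {Q₁ : (E →ᵃ[ℝ] F) → Prop} {Q₂ : (F →ᵃ[ℝ] G) → Prop} {Q : (E →ᵃ[ℝ] G) → Prop}
    {f : E → F} {g : F → G} (hg : PiecewiseAffineOn Q₂ g univ) {S : Set E}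
    (hf : PiecewiseAffineOn Q₁ f S) (hQ : ∀ A B, Q₁ A → Q₂ B → Q (B.comp A)) :
    PiecewiseAffineOn Q (g ∘ f) S := by
  refine Cuttable.bind hf fun T _ ⟨A, hA, hfA⟩ => ?_
  refine Cuttable.bind (Cuttable.mono ?_ (Cuttable.preimage hg A) (subset_univ T)) ?_
  · exact fun U V hUV ⟨W, hW, h⟩ => ⟨W, hUV.trans hW, h⟩
  · rintro U hU ⟨W, hUW, B, hB, hgB⟩
    exact .of_holds ⟨B.comp A, hQ A B hA hB, fun x hx => by
      simp [hfA (hU hx), hgB (hUW hx)]⟩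

lemma max {Q : (E →ᵃ[ℝ] ℝ) → Prop} {f g : E → ℝ} {S : Set E} (hf : PiecewiseAffineOn Q f S)
    (hg : PiecewiseAffineOn Q g S) : PiecewiseAffineOn Q (fun x => Max.max (f x) (g x)) S := by
  refine Cuttable.bind hf fun T hT ⟨A, hA, hfA⟩ => ?_
  refine Cuttable.bind (hg.mono hT) fun U hU ⟨B, hB, hgB⟩ => ?_
  refine .cut (A - B) (.of_holds ⟨A, hA, fun x hx => ?_⟩) (.of_holds ⟨B, hB, fun x hx => ?_⟩)
  · have : 0 ≤ A x - B x := hx.2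
    simp only [hfA (hU hx.1), hgB hx.1]
    exact max_eq_left (by linarith)
  · have : A x - B x ≤ 0 := hx.2
    simp only [hfA (hU hx.1), hgB hx.1]
    exact max_eq_right (by linarith)

lemma min {Q : (E →ᵃ[ℝ] ℝ) → Prop} {f g : E → ℝ} {S : Set E} (hf : PiecewiseAffineOn Q f S)
    (hg : PiecewiseAffineOn Q g S) : PiecewiseAffineOn Q (fun x => Min.min (f x) (g x)) S := by
  refine Cuttable.bind hf fun T hT ⟨A, hA, hfA⟩ => ?_
  refine Cuttable.bind (hg.mono hT) fun U hU ⟨B, hB, hgB⟩ => ?_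
  refine .cut (A - B) (.of_holds ⟨B, hB, fun x hx => ?_⟩) (.of_holds ⟨A, hA, fun x hx => ?_⟩)
  · have : 0 ≤ A x - B x := hx.2
    simp only [hfA (hU hx.1), hgB hx.1]
    exact min_eq_right (by linarith)
  · have : A x - B x ≤ 0 := hx.2
    simp only [hfA (hU hx.1), hgB hx.1]
    exact min_eq_left (by linarith)

end PiecewiseAffineOn

end Cuts

section Cube

variable {n : ℕ}

/-- The vertices `0` and `n • eᵢ` of a simplex containing the unit cube. -/
def bigSimplex (n : ℕ) : Fin (n + 1) → Fin n → ℝ :=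
  Fin.cons 0 fun i => Pi.single i (n : ℝ)

lemma affineIndependent_bigSimplex (n : ℕ) : AffineIndependent ℝ (bigSimplex n) := by
  rw [affineIndependent_iff_forall_eq_zero]
  intro w h1 h2
  have hs : ∀ j : Fin n, w j.succ = 0 := by
    intro j
    have := congrFun h2 j
    have hn : (n : ℝ) ≠ 0 := by
      have := j.pos
      positivity
    simpa [bigSimplex, Fin.sum_univ_succ, Pi.single_apply, hn] using this
  funext i
  refine Fin.cases ?_ hs i
  simpa [Fin.sum_univ_succ, hs] using h1

lemma Icc_subset_convexHull_bigSimplex (n : ℕ) :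
    Icc (0 : Fin n → ℝ) 1 ⊆ convexHull ℝ (range (bigSimplex n)) := by
  intro x hx
  rw [mem_convexHull_range_iff]
  have hsum : ∑ i, x i / n ≤ 1 := by
    rw [← Finset.sum_div]
    refine div_le_one_of_le₀ ?_ (Nat.cast_nonneg n)
    simpa using Finset.sum_le_sum fun i (_ : i ∈ Finset.univ) => hx.2 i
  refine ⟨Fin.cons (1 - ∑ i, x i / n) fun i => x i / n, ?_, ?_, ?_⟩
  · intro i
    refine Fin.cases ?_ (fun j => ?_) i
    · simpa using hsum
    · simpa using div_nonneg (hx.1 j) (Nat.cast_nonneg n)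
  · simp [Fin.sum_univ_succ]
  · funext j
    have hn : (n : ℝ) ≠ 0 := by
      have := j.pos
      positivity
    simp [bigSimplex, Fin.sum_univ_succ, Pi.single_apply, hn]

lemma nonneg_of_mem_convexHull_bigSimplex {x : Fin n → ℝ}
    (hx : x ∈ convexHull ℝ (range (bigSimplex n))) : 0 ≤ x := by
  refine convexHull_min ?_ (convex_Ici (0 : Fin n → ℝ)) hx
  rintro _ ⟨i, rfl⟩
  refine Fin.cases ?_ (fun j => ?_) i
  · simp [bigSimplex]
  · simp [bigSimplex]

lemma cuttable_coordinates (s : Finset (Fin n)) (S : Set (Fin n → ℝ)) :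
    Cuttable (fun T => ∀ i ∈ s, T ⊆ {x | x i ≤ 1} ∨ T ⊆ {x | 1 ≤ x i}) S := by
  induction s using Finset.induction_on with
  | empty => exact .of_holds (by simp)
  | insert j s _ ih =>
    refine ih.bind fun T _ hT => ?_
    refine .cut ((LinearMap.proj j).toAffineMap - AffineMap.const ℝ _ 1) (.of_holds ?_)
      (.of_holds ?_) <;> intro i hi <;> rcases Finset.mem_insert.1 hi with rfl | hi
    · exact Or.inr fun x hx => by simpa using hx.2
    · exact (hT i hi).imp inter_subset_left.trans inter_subset_left.trans
    · exact Or.inl fun x hx => by simpa using hx.2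
    · exact (hT i hi).imp inter_subset_left.trans inter_subset_left.trans

/-- A homeomorphism of the cube that extends to an orientation-preserving piecewise affine map is
an orientation-preserving piecewise linear homeomorphism. -/
theorem isPLCubeHomeo_of_piecewiseAffineOn (f : Cube n ≃ₜ Cube n) {F : (Fin n → ℝ) → Fin n → ℝ}
    (hF : PiecewiseAffineOn (fun A => 0 < LinearMap.det A.linear) F univ)
    (hf : ∀ x, (f x : Fin n → ℝ) = F x) : IsPLCubeHomeo f := by
  let R : Set (Fin n → ℝ) → Prop := fun T =>
    (∀ i ∈ Finset.univ, T ⊆ {x | x i ≤ 1} ∨ T ⊆ {x | 1 ≤ x i}) ∧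
      ∃ A : (Fin n → ℝ) →ᵃ[ℝ] (Fin n → ℝ), 0 < LinearMap.det A.linear ∧ EqOn F A T
  have hR : Antitone R := fun S T hST h =>
    ⟨fun i hi => (h.1 i hi).imp hST.trans hST.trans, antitone_exists_eqOn _ F hST h.2⟩
  have hcut : Cuttable R univ :=
    (cuttable_coordinates Finset.univ univ).bind fun T _ hT =>
      Cuttable.bind (hF.mono (subset_univ T)) fun U hU hA =>
        .of_holds ⟨fun i hi => (hT i hi).imp hU.trans hU.trans, hA⟩
  obtain ⟨κ, _, q, hq, hqd, hqu, hqR⟩ :=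
    hcut.hasSubdivision hR (affineIndependent_bigSimplex n) (subset_univ _)
  classical
  let κ' := {i : κ // convexHull ℝ (range (q i)) ⊆ Icc 0 1}
  let e : Fin (Fintype.card κ') ≃ κ' := (Fintype.equivFin κ').symm
  choose A hA hFA using fun i => (hqR i).2
  refine ⟨Fintype.card κ', fun i => q (e i).1, fun i => A (e i).1, fun i => hq _, ?_, ?_,
    fun i => hA _, fun i x hx => (hf x).trans (hFA _ hx)⟩
  · intro i j hij
    exact (hqd _ _ fun h => hij (e.injective (Subtype.ext h))).inter_eq
  · refine Subset.antisymm (iUnion_subset fun i => (e i).2) ?_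
    have hclosed : IsClosed (⋃ i, convexHull ℝ (range (q (e i).1))) :=
      isClosed_iUnion_of_finite fun i => (finite_range _).isClosed_convexHull ℝ
    intro x hx
    have hlt : ∀ t ∈ Ioo (0 : ℝ) 1, t • x ∈ ⋃ i, convexHull ℝ (range (q (e i).1)) := by
      intro t ht
      have hi1 : ∀ i, (t • x) i < 1 := fun i => by
        have := hx.1 i
        have := hx.2 i
        simp only [Pi.smul_apply, smul_eq_mul, Pi.zero_apply, Pi.one_apply] at *
        nlinarith [ht.1, ht.2]
      have hmem : t • x ∈ Icc (0 : Fin n → ℝ) 1 :=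
        ⟨smul_nonneg ht.1.le hx.1, fun i => (hi1 i).le⟩
      have := Icc_subset_convexHull_bigSimplex n hmem
      rw [← hqu, mem_iUnion] at this
      obtain ⟨k, hk⟩ := this
      refine mem_iUnion.2 ⟨e.symm ⟨k, fun y hy => ⟨?_, fun i => ?_⟩⟩, by simpa using hk⟩
      · refine nonneg_of_mem_convexHull_bigSimplex (hqu ▸ mem_iUnion.2 ⟨k, hy⟩)
      · rcases (hqR k).1 i (Finset.mem_univ i) with h | h
        · exact h hy
        · exact absurd (h hk) (not_le.2 (hi1 i))
    have htend : Filter.Tendsto (fun t : ℝ => t • x) (nhdsWithin 1 (Iio 1)) (nhds x) := by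
      have : Filter.Tendsto (fun t : ℝ => t • x) (nhds 1) (nhds ((1 : ℝ) • x)) :=
        (continuous_id.smul continuous_const).tendsto 1
      rw [one_smul] at this
      exact this.mono_left nhdsWithin_le_nhds
    exact hclosed.mem_of_tendsto htend
      (Filter.mem_of_superset (Ioo_mem_nhdsLT zero_lt_one) hlt)

end Cube

section Shears

/-- A piecewise linear homeomorphism of `[0,1]` that translates by `t` the points far enough from
the endpoints. -/
noncomputable def clampedTranslation (t x : ℝ) : ℝ :=
  max (max (x / 2) (2 * x - 1)) (min (x + t) (min (2 * x) ((x + 1) / 2)))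

lemma clampedTranslation_mem_Icc (t : ℝ) {x : ℝ} (hx : x ∈ Icc (0 : ℝ) 1) :
    clampedTranslation t x ∈ Icc (0 : ℝ) 1 := by
  obtain ⟨h0, h1⟩ := hx
  constructor
  · exact le_max_of_le_left (le_max_of_le_left (by linarith))
  · refine max_le (max_le (by linarith) (by linarith)) (min_le_of_right_le ?_)
    exact min_le_of_right_le (by linarith)

lemma clampedTranslation_neg_clampedTranslation (t : ℝ) {x : ℝ} (hx : x ∈ Icc (0 : ℝ) 1) :
    clampedTranslation (-t) (clampedTranslation t x) = x := by
  obtain ⟨h0, h1⟩ := hx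
  unfold clampedTranslation
  generalize hy : max (max (x / 2) (2 * x - 1)) (min (x + t) (min (2 * x) ((x + 1) / 2))) = y
  grind

lemma clampedTranslation_eq_add {t x : ℝ} (hx : |x - 1 / 2| ≤ 1 / 4) (ht : |t| ≤ 1 / 8) :
    clampedTranslation t x = x + t := by
  rw [abs_le] at hx ht
  unfold clampedTranslation
  rw [min_eq_left (le_min (by linarith) (by linarith)),
    max_eq_right (max_le (by linarith) (by linarith))]

lemma continuous_clampedTranslation : Continuous fun p : ℝ × ℝ => clampedTranslation p.1 p.2 := by
  unfold clampedTranslation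
  fun_prop

variable {n : ℕ}

/-- A map that coincides near the centre of the cube with the transvection adding `t` times the
`j`-th coordinate to the `i`-th one. -/
noncomputable def cubeShear (i j : Fin n) (t : ℝ) (x : Fin n → ℝ) : Fin n → ℝ :=
  Function.update x i (clampedTranslation (t * (x j - 1 / 2)) (x i))

lemma cubeShear_mem (i j : Fin n) (t : ℝ) {x : Fin n → ℝ} (hx : x ∈ Icc (0 : Fin n → ℝ) 1) :
    cubeShear i j t x ∈ Icc (0 : Fin n → ℝ) 1 := by
  rw [← pi_univ_Icc, mem_univ_pi] at hx ⊢
  intro k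
  by_cases hk : k = i
  · subst hk
    simpa [cubeShear] using clampedTranslation_mem_Icc _ (hx k)
  · simpa [cubeShear, hk] using hx k

lemma cubeShear_neg_cubeShear {i j : Fin n} (hij : i ≠ j) (t : ℝ) {x : Fin n → ℝ}
    (hx : x ∈ Icc (0 : Fin n → ℝ) 1) : cubeShear i j (-t) (cubeShear i j t x) = x := by
  have := clampedTranslation_neg_clampedTranslation (t * (x j - 1 / 2)) ⟨hx.1 i, hx.2 i⟩
  simp only [cubeShear, Function.update_self, Function.update_of_ne hij.symm,
    Function.update_idem, neg_mul, this, Function.update_eq_self]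

lemma continuous_cubeShear (i j : Fin n) (t : ℝ) : Continuous (cubeShear i j t) := by
  refine continuous_id.update i (continuous_clampedTranslation.comp
    (f := fun x : Fin n → ℝ => (t * (x j - 1 / 2), x i)) ?_)
  fun_prop

/-- `cubeShear` as a homeomorphism of the cube. -/
noncomputable def cubeShearHomeo {i j : Fin n} (hij : i ≠ j) (t : ℝ) : Cube n ≃ₜ Cube n where
  toFun x := ⟨cubeShear i j t x, cubeShear_mem i j t x.2⟩
  invFun x := ⟨cubeShear i j (-t) x, cubeShear_mem i j (-t) x.2⟩
  left_inv x := Subtype.ext (cubeShear_neg_cubeShear hij t x.2)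
  right_inv x := Subtype.ext (by simpa using cubeShear_neg_cubeShear hij (-t) x.2)
  continuous_toFun := ((continuous_cubeShear i j t).comp continuous_subtype_val).subtype_mk _
  continuous_invFun := ((continuous_cubeShear i j (-t)).comp continuous_subtype_val).subtype_mk _

lemma inv_cubeShearHomeo {i j : Fin n} (hij : i ≠ j) (t : ℝ) :
    (cubeShearHomeo hij t)⁻¹ = cubeShearHomeo hij (-t) :=
  Homeomorph.ext fun _ => rfl

lemma piecewiseAffineOn_coordinates {i j : Fin n} (hij : i ≠ j) {a : ℝ} (ha : 0 < a) (b c : ℝ) :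
    PiecewiseAffineOn (fun A : (Fin n → ℝ) →ᵃ[ℝ] ℝ => 0 < A.linear (Pi.single i 1))
      (fun x => a * x i + b * x j + c) univ := by
  refine .of_holds ⟨(a • LinearMap.proj i + b • LinearMap.proj j : (Fin n → ℝ) →ₗ[ℝ] ℝ).toAffineMap +
    AffineMap.const ℝ _ c, ?_, fun x _ => ?_⟩
  · simpa [hij.symm] using ha
  · simp

lemma piecewiseAffineOn_clampedTranslation {i j : Fin n} (hij : i ≠ j) (t : ℝ) :
    PiecewiseAffineOn (fun A : (Fin n → ℝ) →ᵃ[ℝ] ℝ => 0 < A.linear (Pi.single i 1))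
      (fun x => clampedTranslation (t * (x j - 1 / 2)) (x i)) univ := by
  have h {a : ℝ} (ha : 0 < a) (b c : ℝ) := piecewiseAffineOn_coordinates hij ha b c
  convert ((h (a := 1 / 2) (by norm_num) 0 0).max (h (a := 2) (by norm_num) 0 (-1))).max
    ((h (a := 1) (by norm_num) t (-t / 2)).min
      ((h (a := 2) (by norm_num) 0 0).min (h (a := 1 / 2) (by norm_num) 0 (1 / 2)))) using 2 with x
  unfold clampedTranslation
  congr 2 <;> [skip; skip; skip; congr 1] <;> ring

/-- Replace the `i`-th coordinate by the value of an affine function. -/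
noncomputable def updateAffine (i : Fin n) (A : (Fin n → ℝ) →ᵃ[ℝ] ℝ) : (Fin n → ℝ) →ᵃ[ℝ] (Fin n → ℝ) :=
  (LinearMap.transvection (A.linear - LinearMap.proj i) (Pi.single i 1)).toAffineMap +
    AffineMap.const ℝ (Fin n → ℝ) (Pi.single i (A 0) : Fin n → ℝ)

lemma updateAffine_apply (i : Fin n) (A : (Fin n → ℝ) →ᵃ[ℝ] ℝ) (x : Fin n → ℝ) :
    updateAffine i A x = Function.update x i (A x) := by
  have hA : A x = A.linear x + A 0 := by
    have := A.map_vadd 0 x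
    simpa using this
  funext k
  by_cases hk : k = i
  · subst hk
    simp [updateAffine, LinearMap.transvection.apply, hA]
  · simp [updateAffine, LinearMap.transvection.apply, hk]

lemma det_updateAffine (i : Fin n) (A : (Fin n → ℝ) →ᵃ[ℝ] ℝ) :
    LinearMap.det (updateAffine i A).linear = A.linear (Pi.single i 1) := by
  have : (updateAffine i A).linear =
      LinearMap.transvection (A.linear - LinearMap.proj i) (Pi.single i 1) := by
    simp [updateAffine]
  rw [this, LinearMap.transvection.det]
  simp

lemma piecewiseAffineOn_cubeShear {i j : Fin n} (hij : i ≠ j) (t : ℝ) :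
    PiecewiseAffineOn (fun A => 0 < LinearMap.det A.linear) (cubeShear i j t) univ := by
  refine Cuttable.bind (piecewiseAffineOn_clampedTranslation hij t) ?_
  rintro T - ⟨A, hA, h⟩
  refine .of_holds ⟨updateAffine i A, hA.trans_eq (det_updateAffine i A).symm, fun x hx => ?_⟩
  rw [updateAffine_apply, ← h hx, cubeShear]

/-- The homeomorphisms of the cube that extend to orientation-preserving piecewise affine maps. -/
def piecewiseAffineSubmonoid (n : ℕ) : Submonoid (Cube n ≃ₜ Cube n) where
  carrier := {f | ∃ F : (Fin n → ℝ) → Fin n → ℝ,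
    PiecewiseAffineOn (fun A => 0 < LinearMap.det A.linear) F univ ∧ ∀ x, (f x : Fin n → ℝ) = F x}
  one_mem' := ⟨AffineMap.id ℝ _, .of_affineMap (by simp) univ, fun _ => rfl⟩
  mul_mem' := by
    rintro f g ⟨F, hF, hf⟩ ⟨G, hG, hg⟩
    refine ⟨F ∘ G, hF.comp hG fun A B hA hB => ?_, fun x => ?_⟩
    · rw [AffineMap.comp_linear, LinearMap.det_comp]
      exact mul_pos hB hA
    · rw [Function.comp_apply, ← hg, ← hf]
      rfl

lemma cubeShearHomeo_mem {i j : Fin n} (hij : i ≠ j) (t : ℝ) :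
    cubeShearHomeo hij t ∈ piecewiseAffineSubmonoid n :=
  ⟨cubeShear i j t, piecewiseAffineOn_cubeShear hij t, fun _ => rfl⟩

end Shears

section PingPong

lemma Fin.two_one_sub_ne (k : Fin 2) : 1 - k ≠ k := by
  decide +revert

/-- The transvection of `ℝ²` adding `t` times the other coordinate to the `k`-th one. -/
def planeShear (k : Fin 2) (t : ℝ) (v : Fin 2 → ℝ) : Fin 2 → ℝ :=
  Function.update v k (v k + t * v (1 - k))

@[simp]
lemma planeShear_self (k : Fin 2) (t : ℝ) (v : Fin 2 → ℝ) :
    planeShear k t v k = v k + t * v (1 - k) := by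
  simp [planeShear]

@[simp]
lemma planeShear_other (k : Fin 2) (t : ℝ) (v : Fin 2 → ℝ) :
    planeShear k t v (1 - k) = v (1 - k) := by
  simp [planeShear, Fin.two_one_sub_ne]

lemma planeShear_neg_planeShear (k : Fin 2) (t : ℝ) (v : Fin 2 → ℝ) :
    planeShear k (-t) (planeShear k t v) = v := by
  rw [planeShear, planeShear_self, planeShear_other, planeShear, Function.update_idem,
    neg_mul, add_neg_cancel_right, Function.update_eq_self]

lemma planeShear_ne_zero (k : Fin 2) (t : ℝ) {v : Fin 2 → ℝ} (hv : v ≠ 0) :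
    planeShear k t v ≠ 0 := by
  intro h
  apply hv
  rw [← planeShear_neg_planeShear k t v, h]
  simp [planeShear]

/-- `planeShear` as a permutation of the nonzero vectors. -/
def planeShearPerm (k : Fin 2) (t : ℝ) : Equiv.Perm {v : Fin 2 → ℝ // v ≠ 0} where
  toFun v := ⟨planeShear k t v, planeShear_ne_zero k t v.2⟩
  invFun v := ⟨planeShear k (-t) v, planeShear_ne_zero k (-t) v.2⟩
  left_inv v := Subtype.ext (planeShear_neg_planeShear k t v)
  right_inv v := Subtype.ext (by simpa using planeShear_neg_planeShear k (-t) v)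

lemma inv_planeShearPerm (k : Fin 2) (t : ℝ) :
    (planeShearPerm k t)⁻¹ = planeShearPerm k (-t) :=
  Equiv.ext fun _ => rfl

/-- The permutations of the nonzero vectors of `ℝ²` induced by the shears
`(x, y) ↦ (x + 3 y, y)` and `(x, y) ↦ (x, y + 3 x)` generate a free group. -/
theorem injective_lift_planeShearPerm :
    Function.Injective (FreeGroup.lift fun k => planeShearPerm k 3) := by
  refine FreeGroup.injective_lift_of_ping_pong (fun k => planeShearPerm k 3)
    (fun k => {v : {v : Fin 2 → ℝ // v ≠ 0} | v.1 (1 - k) = 0 ∨ 0 < v.1 (1 - k) * (v.1 k - v.1 (1 - k))})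
    (fun k => {v : {v : Fin 2 → ℝ // v ≠ 0} | v.1 (1 - k) ≠ 0 ∧ v.1 (1 - k) * (v.1 k + 2 * v.1 (1 - k)) ≤ 0})
    ?_ ?_ ?_ ?_ ?_ ?_
  · intro k
    refine ⟨⟨Pi.single k 1, by simp⟩, Or.inl ?_⟩
    simp [Fin.two_one_sub_ne]
  · have h : ∀ v : {v : Fin 2 → ℝ // v ≠ 0},
        ¬((v.1 1 = 0 ∨ 0 < v.1 1 * (v.1 0 - v.1 1)) ∧
          (v.1 0 = 0 ∨ 0 < v.1 0 * (v.1 1 - v.1 0))) := by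
      rintro v ⟨h₁ | h₁, h₂ | h₂⟩
      · exact v.2 (funext (Fin.forall_fin_two.2 ⟨h₂, h₁⟩))
      · rw [h₁] at h₂
        nlinarith [mul_self_nonneg (v.1 0)]
      · rw [h₂] at h₁
        nlinarith [mul_self_nonneg (v.1 1)]
      · nlinarith [sq_nonneg (v.1 0 - v.1 1)]
    intro k l hkl
    refine Set.disjoint_left.2 fun v h₁ h₂ => ?_
    fin_cases k <;> fin_cases l
    exacts [hkl rfl, h v ⟨h₁, h₂⟩, h v ⟨h₂, h₁⟩, hkl rfl]
  · have h : ∀ v : {v : Fin 2 → ℝ // v ≠ 0},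
        ¬((v.1 1 ≠ 0 ∧ v.1 1 * (v.1 0 + 2 * v.1 1) ≤ 0) ∧
          (v.1 0 ≠ 0 ∧ v.1 0 * (v.1 1 + 2 * v.1 0) ≤ 0)) := by
      rintro v ⟨⟨h₁, h₂⟩, h₃, h₄⟩
      have := mul_self_pos.2 h₁
      nlinarith [sq_nonneg (v.1 0 + v.1 1), mul_self_pos.2 h₃]
    intro k l hkl
    refine Set.disjoint_left.2 fun v h₁ h₂ => ?_
    fin_cases k <;> fin_cases l
    exacts [hkl rfl, h v ⟨h₁, h₂⟩, h v ⟨h₂, h₁⟩, hkl rfl]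
  · intro k l
    refine Set.disjoint_left.2 fun v h₁ h₂ => ?_
    by_cases hkl : k = l
    · subst hkl
      rcases h₁ with h₁ | h₁
      · exact h₂.1 h₁
      · nlinarith [h₂.2, mul_self_nonneg (v.1 (1 - k))]
    · obtain rfl : l = 1 - k := by clear h₁ h₂; decide +revert
      obtain ⟨h₂, h₃⟩ := h₂
      rw [sub_sub_cancel] at h₂ h₃
      have := mul_self_pos.2 h₂
      rcases h₁ with h₁ | h₁
      · rw [h₁] at h₃
        nlinarith
      · nlinarith [mul_self_nonneg (v.1 (1 - k))]
  · rintro k _ ⟨v, hv, rfl⟩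
    change planeShear k 3 v.1 (1 - k) = 0 ∨
      0 < planeShear k 3 v.1 (1 - k) * (planeShear k 3 v.1 k - planeShear k 3 v.1 (1 - k))
    rw [planeShear_self, planeShear_other]
    by_contra! h
    refine hv ⟨h.1, ?_⟩
    linarith [h.2]
  · rintro k _ ⟨v, hv, rfl⟩
    change planeShear k (-3) v.1 (1 - k) ≠ 0 ∧
      planeShear k (-3) v.1 (1 - k) *
        (planeShear k (-3) v.1 k + 2 * planeShear k (-3) v.1 (1 - k)) ≤ 0
    rw [planeShear_self, planeShear_other]
    refine ⟨fun h => hv (Or.inl h), not_lt.1 fun h => hv (Or.inr ?_)⟩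
    linarith

end PingPong

section FreeSubgroup

variable {n : ℕ}

lemma castLE_ne_castLE_one_sub (hn : 2 ≤ n) (k : Fin 2) :
    Fin.castLE hn k ≠ Fin.castLE hn (1 - k) :=
  fun h => Fin.two_one_sub_ne k (Fin.castLE_injective hn h).symm

/-- The first two coordinates of `x` are those of the centre of the cube plus `ε • v`. -/
def IsNearCenter (hn : 2 ≤ n) (v : Fin 2 → ℝ) (ε : ℝ) (x : Cube n) : Prop :=
  ∀ k, x.1 (Fin.castLE hn k) = 1 / 2 + ε * v k

lemma exists_isNearCenter (hn : 2 ≤ n) {v : Fin 2 → ℝ} {ε : ℝ} (h : ∀ k, |ε * v k| ≤ 1 / 2) :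
    ∃ x, IsNearCenter hn v ε x := by
  refine ⟨⟨fun m => if hm : m.1 < 2 then 1 / 2 + ε * v ⟨m, hm⟩ else 1 / 2, ?_, ?_⟩, fun k => ?_⟩
  · intro m
    dsimp only
    split_ifs with hm
    · have := (abs_le.1 (h ⟨m, hm⟩)).1
      simp only [Pi.zero_apply]
      linarith
    · simp
  · intro m
    dsimp only
    split_ifs with hm
    · have := (abs_le.1 (h ⟨m, hm⟩)).2
      simp only [Pi.one_apply]
      linarith
    · simp only [Pi.one_apply]
      norm_num
  · simp [k.isLt]

lemma eventually_abs_mul_le {δ : ℝ} (hδ : 0 < δ) (a : ℝ) :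
    ∀ᶠ ε in nhdsWithin (0 : ℝ) (Ioi 0), |ε * a| ≤ δ := by
  have h : Filter.Tendsto (fun ε : ℝ => |ε * a|) (nhds 0) (nhds |0 * a|) :=
    (continuous_id.mul continuous_const).abs.tendsto 0
  rw [zero_mul, abs_zero] at h
  exact (h.mono_left nhdsWithin_le_nhds).eventually_le_const hδ

/-- Near the centre of the cube, `f` acts on the first two coordinates as the permutation `M` of
directions. -/
def ActsNearCenter (hn : 2 ≤ n) (f : Cube n ≃ₜ Cube n)
    (M : Equiv.Perm {v : Fin 2 → ℝ // v ≠ 0}) : Prop :=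
  ∀ v, ∀ᶠ ε in nhdsWithin (0 : ℝ) (Ioi 0), ∀ x,
    IsNearCenter hn v.1 ε x → IsNearCenter hn (M v).1 ε (f x)

lemma ActsNearCenter.one (hn : 2 ≤ n) : ActsNearCenter hn 1 1 :=
  fun _ => .of_forall fun _ _ h => h

lemma ActsNearCenter.mul {hn : 2 ≤ n} {f g : Cube n ≃ₜ Cube n}
    {M N : Equiv.Perm {v : Fin 2 → ℝ // v ≠ 0}} (hf : ActsNearCenter hn f M)
    (hg : ActsNearCenter hn g N) : ActsNearCenter hn (f * g) (M * N) := by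
  intro v
  filter_upwards [hg v, hf (N v)] with ε h₁ h₂ x hx
  exact h₂ _ (h₁ x hx)

lemma actsNearCenter_cubeShearHomeo (hn : 2 ≤ n) (k : Fin 2) (t : ℝ) :
    ActsNearCenter hn (cubeShearHomeo (castLE_ne_castLE_one_sub hn k) t) (planeShearPerm k t) := by
  intro v
  filter_upwards [eventually_abs_mul_le (δ := 1 / 4) (by norm_num) (v.1 k),
    eventually_abs_mul_le (δ := 1 / 8) (by norm_num) (t * v.1 (1 - k))] with ε h₁ h₂ x hx l
  change cubeShear (Fin.castLE hn k) (Fin.castLE hn (1 - k)) t x.1 (Fin.castLE hn l) =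
    1 / 2 + ε * planeShear k t v.1 l
  by_cases hl : l = k
  · subst hl
    have hother : t * (x.1 (Fin.castLE hn (1 - l)) - 1 / 2) = ε * (t * v.1 (1 - l)) := by
      rw [hx]
      ring
    rw [planeShear_self, cubeShear, Function.update_self, hother, hx,
      clampedTranslation_eq_add (by simpa using h₁) h₂]
    ring
  · rw [cubeShear, Function.update_of_ne fun h => hl (Fin.castLE_injective hn h), planeShear,
      Function.update_of_ne hl, hx]

lemma ActsNearCenter.eq_one {hn : 2 ≤ n} {M : Equiv.Perm {v : Fin 2 → ℝ // v ≠ 0}}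
    (h : ActsNearCenter hn 1 M) : M = 1 := by
  refine Equiv.ext fun v => Subtype.ext (funext fun k => ?_)
  obtain ⟨ε, ⟨h₁, h₂⟩, hε⟩ := (((h v).and (Filter.eventually_all.2 fun k =>
    eventually_abs_mul_le (δ := 1 / 2) (by norm_num) (v.1 k))).and
      self_mem_nhdsWithin).exists
  obtain ⟨x, hx⟩ := exists_isNearCenter hn h₂
  have hMx : x.1 (Fin.castLE hn k) = 1 / 2 + ε * (M v).1 k := h₁ x hx k
  rw [hx k] at hMx
  exact (mul_left_cancel₀ (ne_of_gt hε) (add_left_cancel hMx)).symm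

/-- The homomorphism sending the two generators to shears in the first two coordinates. -/
noncomputable def shearHom (hn : 2 ≤ n) : FreeGroup (Fin 2) →* (Cube n ≃ₜ Cube n) :=
  FreeGroup.lift fun k => cubeShearHomeo (castLE_ne_castLE_one_sub hn k) 3

lemma actsNearCenter_shearHom (hn : 2 ≤ n) (w : FreeGroup (Fin 2)) :
    ActsNearCenter hn (shearHom hn w) (FreeGroup.lift (fun k => planeShearPerm k 3) w) := by
  induction w using FreeGroup.induction_on with
  | C1 => simpa using .one hn
  | of k => simpa [shearHom] using actsNearCenter_cubeShearHomeo hn k 3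
  | inv_of k _ =>
    simpa [shearHom, inv_cubeShearHomeo, inv_planeShearPerm] using
      actsNearCenter_cubeShearHomeo hn k (-3)
  | mul v w hv hw => simpa using hv.mul hw

lemma shearHom_mem (hn : 2 ≤ n) (w : FreeGroup (Fin 2)) :
    shearHom hn w ∈ piecewiseAffineSubmonoid n := by
  induction w using FreeGroup.induction_on with
  | C1 => simp
  | of k => simpa [shearHom] using cubeShearHomeo_mem (castLE_ne_castLE_one_sub hn k) 3
  | inv_of k _ =>
    simpa [shearHom, inv_cubeShearHomeo] using
      cubeShearHomeo_mem (castLE_ne_castLE_one_sub hn k) (-3)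
  | mul v w hv hw => simpa using mul_mem hv hw

lemma injective_shearHom (hn : 2 ≤ n) : Function.Injective (shearHom hn) := by
  refine (injective_iff_map_eq_one _).2 fun w hw => ?_
  have := actsNearCenter_shearHom hn w
  rw [hw] at this
  exact (injective_iff_map_eq_one _).1 injective_lift_planeShearPerm w this.eq_one

end FreeSubgroup

end PiecewiseLinear

/-- For every `n ≥ 2`, the group `PL(Iⁿ)` of orientation-preserving piecewise linear
homeomorphisms of the cube contains a subgroup isomorphic to the free group of rank 2. -/
theorem plCube_contains_free_subgroup (n : ℕ) (hn : 2 ≤ n) :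
    ∃ φ : FreeGroup (Fin 2) →* Homeomorph (Cube n) (Cube n),
      Function.Injective φ ∧ ∀ w, IsPLCubeHomeo (φ w) := by
  refine ⟨shearHom hn, injective_shearHom hn, fun w => ?_⟩
  obtain ⟨F, hF, h⟩ := shearHom_mem hn w
  exact isPLCubeHomeo_of_piecewiseAffineOn _ hF h
end
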